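/- arXiv:2004.13116 — 7 statements merged into one kernel-verified Lean document; each statement's English description precedes it below -/
import Mathlib

section
/- For every matroid M with finite ground set E and rank d, the f-vector of the independence complex of M is log-concave: f_{k-1}·f_{k+1} ≤ f_k² for all 0 < k < d, where f_k is the number of independent sets of M of cardinality k. -/
/-- The rank of a set `X` in a matroid `M`: the supremum of the cardinalities of the
independent subsets of `X`. -/
noncomputable def matroidRank {α : Type*} (M : Matroid α) (X : Set α) : ℕ :=
  sSup {m | ∃ I ⊆ X, M.Indep I ∧ I.ncard = m}

/-- The number of independent sets of cardinality `k` in the matroid `M`: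
the `k`-th entry of the f-vector of the independence complex of `M`. -/
noncomputable def indepCount {α : Type*} (M : Matroid α) (k : ℕ) : ℕ :=
  {I : Set α | M.Indep I ∧ I.ncard = k}.ncard

section WeightedForms

variable {n : Type*} [Fintype n]

/-- A real symmetric matrix is diagonalized by a basis orthonormal for a weighted inner product. -/
lemma exists_weighted_eigenbasis (H : n → n → ℝ) (hH : ∀ x y, H x y = H y x)
    (s : n → ℝ) (hs : ∀ x, 0 < s x) :
    ∃ (g : n → n → ℝ) (l : n → ℝ), (∀ k x, ∑ y, H x y * g k y = l k * s x * g k x) ∧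
      ∀ (w : n → ℝ) (x : n), w x = ∑ k, (∑ y, s y * g k y * w y) * g k x := by
  classical
  set N : Matrix n n ℝ := Matrix.of fun x y => H x y / (√(s x) * √(s y)) with hN
  have hr : ∀ x, 0 < √(s x) := fun x => Real.sqrt_pos.2 (hs x)
  have hr2 : ∀ x, √(s x) * √(s x) = s x := fun x => Real.mul_self_sqrt (hs x).le
  have hA : N.IsHermitian := by
    ext x y
    simp [hN, hH y x, mul_comm]
  refine ⟨fun k x => hA.eigenvectorBasis k x / √(s x), hA.eigenvalues, fun k x => ?_, fun w x => ?_⟩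
  · have h := congrFun (hA.mulVec_eigenvectorBasis k) x
    simp only [Matrix.mulVec, dotProduct, hN, Matrix.of_apply, Pi.smul_apply, smul_eq_mul] at h
    have h2 : ∑ y, H x y * (hA.eigenvectorBasis k y / √(s y)) =
        √(s x) * ∑ y, H x y / (√(s x) * √(s y)) * hA.eigenvectorBasis k y := by
      rw [Finset.mul_sum]
      refine Finset.sum_congr rfl fun y _ => ?_
      have := hr x
      have := hr y
      field_simp
    rw [h2, h]
    have := hr x
    field_simp
    rw [Real.sq_sqrt (hs x).le]
    ring
  · set u : EuclideanSpace ℝ n := WithLp.toLp 2 fun x => √(s x) * w x with hu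
    have h := congrArg (fun v : EuclideanSpace ℝ n => v x) (hA.eigenvectorBasis.sum_repr' u)
    simp only [hu, PiLp.inner_apply, WithLp.ofLp_sum, WithLp.ofLp_smul, Finset.sum_apply,
      Pi.smul_apply, smul_eq_mul, RCLike.inner_apply, conj_trivial] at h
    have := hr x
    rw [← mul_right_inj' this.ne', ← h, Finset.mul_sum]
    refine Finset.sum_congr rfl fun k _ => ?_
    rw [show ∑ y, s y * (hA.eigenvectorBasis k y / √(s y)) * w y =
      ∑ y, √(s y) * w y * hA.eigenvectorBasis k y from Finset.sum_congr rfl fun y _ => by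
        have := hr y
        nth_rewrite 1 [← hr2 y]
        field_simp]
    field_simp

/-- The bilinear form with matrix `H`. -/
def bform (H : n → n → ℝ) (v w : n → ℝ) : ℝ := ∑ x, v x * ∑ y, H x y * w y

lemma bform_comm {H : n → n → ℝ} (hH : ∀ x y, H x y = H y x) (v w : n → ℝ) :
    bform H v w = bform H w v := by
  simp only [bform, Finset.mul_sum]
  rw [Finset.sum_comm]
  refine Finset.sum_congr rfl fun x _ => Finset.sum_congr rfl fun y _ => ?_
  rw [hH y x]; ring

lemma bform_add_smul_self {H : n → n → ℝ} (hH : ∀ x y, H x y = H y x) (v a : n → ℝ) (t : ℝ) :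
    bform H (fun x => v x + t * a x) (fun x => v x + t * a x) =
      bform H v v + 2 * t * bform H a v + t ^ 2 * bform H a a := by
  have h : bform H (fun x => v x + t * a x) (fun x => v x + t * a x) =
      bform H v v + t * bform H a v + t * bform H v a + t ^ 2 * bform H a a := by
    simp only [bform, Finset.mul_sum, ← Finset.sum_add_distrib]
    refine Finset.sum_congr rfl fun x _ => Finset.sum_congr rfl fun y _ => ?_
    ring
  rw [h, bform_comm hH v a]; ring

/-- The reversed Cauchy–Schwarz inequality holds as soon as every line in the direction `a`
contains a vector on which the form is nonpositive. -/
lemma bform_mul_le_sq {H : n → n → ℝ} (hH : ∀ x y, H x y = H y x) {a v : n → ℝ}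
    (ha : 0 ≤ bform H a a) {t : ℝ}
    (ht : bform H (fun x => v x + t * a x) (fun x => v x + t * a x) ≤ 0) :
    bform H a a * bform H v v ≤ bform H a v ^ 2 := by
  rw [bform_add_smul_self hH] at ht
  nlinarith [mul_nonneg ha (neg_nonneg.2 ht), sq_nonneg (bform H a v + t * bform H a a)]

/-- Perron–Frobenius type statement: an eigenvector with positive eigenvalue is, under a spectral
gap hypothesis, proportional to the Perron vector `a`, so that it annihilates every vector
which is `H`-orthogonal to `a`. -/
lemma weighted_sum_eigenvector_eq_zero {H : n → n → ℝ} (hH : ∀ x y, H x y = H y x)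
    (hpos : ∀ x y, 0 ≤ H x y) {a : n → ℝ} (ha : ∀ x, 0 < a x) (o : n)
    (hrow : ∀ x, H o x = 0 → ∀ y, H x y = 0) {s : n → ℝ} (hs : ∀ x, 0 < s x)
    (hds : ∀ x, ∑ y, H x y * a y ≤ s x * a x) {c : ℝ} (hc : 0 < c) {g : n → ℝ}
    (hg : ∀ x, ∑ y, H x y * g y = c * s x * g x)
    (hgap : bform H g g ≤ ∑ x, (∑ y, H x y * g y) ^ 2 / s x) {w : n → ℝ}
    (hw : bform H a w = 0) : ∑ y, s y * g y * w y = 0 := by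
  set T := ∑ x, s x * g x ^ 2 with hT
  have hgg : bform H g g = c * T := by
    simp only [bform, hg, hT, Finset.mul_sum]
    exact Finset.sum_congr rfl fun x _ => by ring
  have hcT : T ≤ c * T := by
    have h : ∑ x, (∑ y, H x y * g y) ^ 2 / s x = c * (c * T) := by
      simp only [hg, hT, Finset.mul_sum]
      refine Finset.sum_congr rfl fun x _ => ?_
      have := (hs x).ne'
      field_simp
    rw [hgg, h] at hgap
    exact le_of_mul_le_mul_left hgap hc
  have hterm : ∀ x y, 0 ≤ H x y * a x * a y * (g x / a x - g y / a y) ^ 2 := fun x y =>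
    mul_nonneg (mul_nonneg (mul_nonneg (hpos x y) (ha x).le) (ha y).le) (sq_nonneg _)
  have hdir : ∑ x, ∑ y, H x y * a x * a y * (g x / a x - g y / a y) ^ 2 =
      2 * ∑ x, g x ^ 2 / a x * (∑ y, H x y * a y) - 2 * bform H g g := by
    have h1 : ∑ x, ∑ y, H x y * (g y ^ 2 / a y) * a x =
        ∑ x, g x ^ 2 / a x * (∑ y, H x y * a y) := by
      rw [Finset.sum_comm]
      simp only [Finset.mul_sum]
      refine Finset.sum_congr rfl fun x _ => Finset.sum_congr rfl fun y _ => ?_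
      rw [hH y x]; ring
    rw [two_mul]
    nth_rewrite 1 [← h1]
    simp only [bform, Finset.mul_sum, ← Finset.sum_add_distrib, ← Finset.sum_sub_distrib]
    refine Finset.sum_congr rfl fun x _ => Finset.sum_congr rfl fun y _ => ?_
    have := (ha x).ne'
    have := (ha y).ne'
    field_simp
    ring
  have hle : ∑ x, g x ^ 2 / a x * (∑ y, H x y * a y) ≤ T := by
    refine Finset.sum_le_sum fun x _ => ?_
    calc g x ^ 2 / a x * (∑ y, H x y * a y) ≤ g x ^ 2 / a x * (s x * a x) :=
          mul_le_mul_of_nonneg_left (hds x) (div_nonneg (sq_nonneg _) (ha x).le)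
      _ = s x * g x ^ 2 := by have := (ha x).ne'; field_simp
  have hzero : ∑ x, ∑ y, H x y * a x * a y * (g x / a x - g y / a y) ^ 2 = 0 :=
    le_antisymm (by rw [hdir, hgg]; linarith)
      (Finset.sum_nonneg fun x _ => Finset.sum_nonneg fun y _ => hterm x y)
  have hprop : ∀ y, H o y ≠ 0 → g y = g o / a o * a y := by
    intro y hy
    rw [Finset.sum_eq_zero_iff_of_nonneg
      fun x _ => Finset.sum_nonneg fun y _ => hterm x y] at hzero
    have h := hzero o (Finset.mem_univ _)
    rw [Finset.sum_eq_zero_iff_of_nonneg fun y _ => hterm o y] at h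
    have h := h y (Finset.mem_univ _)
    have hne : H o y * a o * a y ≠ 0 := mul_ne_zero (mul_ne_zero hy (ha o).ne') (ha y).ne'
    have h := pow_eq_zero_iff two_ne_zero |>.1 ((mul_eq_zero.1 h).resolve_left hne)
    rw [sub_eq_zero] at h
    rw [h, div_mul_cancel₀ _ (ha y).ne']
  have hHg : ∀ x y, H x y * g y = g o / a o * (H x y * a y) := by
    intro x y
    by_cases hy : H o y = 0
    · rw [hH x y, hrow y hy x]; ring
    · rw [hprop y hy]; ring
  have hfin : c * ∑ y, s y * g y * w y = g o / a o * bform H w a := by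
    simp only [bform, Finset.mul_sum]
    refine Finset.sum_congr rfl fun x _ => ?_
    calc c * (s x * g x * w x) = w x * ∑ y, H x y * g y := by rw [hg]; ring
      _ = _ := by
        rw [Finset.mul_sum]
        exact Finset.sum_congr rfl fun y _ => by rw [hHg]; ring
  rw [bform_comm hH w a, hw, mul_zero] at hfin
  exact (mul_eq_zero.1 hfin).resolve_left hc.ne'

/-- Local-to-global principle: if `H` is the weighted sum of forms `q x`, each of which satisfies
the reversed Cauchy–Schwarz inequality in the direction `a`, then so does `H`. -/
lemma bform_mul_le_sq_of_local {H : n → n → ℝ} (hH : ∀ x y, H x y = H y x)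
    (hpos : ∀ x y, 0 ≤ H x y) {a : n → ℝ} (ha : ∀ x, 0 < a x) (o : n)
    (hrow : ∀ x, H o x = 0 → ∀ y, H x y = 0) (q : n → (n → ℝ) → ℝ)
    (hq : ∀ v, bform H v v = ∑ x, a x * q x v)
    (hq0 : ∀ x, H o x = 0 → ∀ v, q x v = 0)
    (hloc : ∀ x v, (∑ y, H x y * a y) * q x v ≤ (∑ y, H x y * v y) ^ 2) (v : n → ℝ) :
    bform H a a * bform H v v ≤ bform H a v ^ 2 := by
  classical
  have haa : 0 ≤ bform H a a := Finset.sum_nonneg fun x _ => mul_nonneg (ha x).le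
    (Finset.sum_nonneg fun y _ => mul_nonneg (hpos x y) (ha y).le)
  rcases haa.eq_or_lt with h0 | h0
  · rw [← h0, zero_mul]; positivity
  suffices key : ∀ w, bform H a w = 0 → bform H w w ≤ 0 by
    refine bform_mul_le_sq hH haa (t := -(bform H a v / bform H a a)) (key _ ?_)
    have : bform H a (fun x => v x + -(bform H a v / bform H a a) * a x) =
        bform H a v + -(bform H a v / bform H a a) * bform H a a := by
      generalize -(bform H a v / bform H a a) = t
      simp only [bform, Finset.mul_sum, ← Finset.sum_add_distrib]
      refine Finset.sum_congr rfl fun x _ => Finset.sum_congr rfl fun y _ => ?_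
      ring
    rw [this]; field_simp; ring
  intro w hw
  set d : n → ℝ := fun x => ∑ y, H x y * a y with hd
  have hdpos : ∀ x, H o x ≠ 0 → 0 < d x := fun x hx =>
    Finset.sum_pos' (fun y _ => mul_nonneg (hpos x y) (ha y).le)
      ⟨o, Finset.mem_univ _, mul_pos ((hpos x o).lt_of_ne' (by rwa [hH x o])) (ha o)⟩
  set s : n → ℝ := fun x => if H o x = 0 then 1 else d x / a x with hs
  have hspos : ∀ x, 0 < s x := by
    intro x
    by_cases hx : H o x = 0
    · simp [hs, hx]
    · simp only [hs, hx, if_false]; exact div_pos (hdpos x hx) (ha x)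
  have hds : ∀ x, d x ≤ s x * a x := by
    intro x
    by_cases hx : H o x = 0
    · have : d x = 0 := Finset.sum_eq_zero fun y _ => by rw [hrow x hx y, zero_mul]
      rw [this]; exact mul_nonneg (hspos x).le (ha x).le
    · simp only [hs, hx, if_false]; rw [div_mul_cancel₀ _ (ha x).ne']
  have hstar : ∀ v, bform H v v ≤ ∑ x, (∑ y, H x y * v y) ^ 2 / s x := by
    intro v
    rw [hq]
    refine Finset.sum_le_sum fun x _ => ?_
    by_cases hx : H o x = 0
    · rw [hq0 x hx v, mul_zero]; exact div_nonneg (sq_nonneg _) (hspos x).le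
    · rw [le_div_iff₀ (hspos x)]
      simp only [hs, hx, if_false]
      calc a x * q x v * (d x / a x) = d x * q x v := by have := (ha x).ne'; field_simp
        _ ≤ _ := hloc x v
  obtain ⟨g, l, hg, hexp⟩ := exists_weighted_eigenbasis H hH s hspos
  have hww : bform H w w = ∑ k, l k * (∑ y, s y * g k y * w y) ^ 2 := by
    have h1 : ∀ x, ∑ y, H x y * w y = ∑ k, (∑ y, s y * g k y * w y) * (l k * s x * g k x) := by
      intro x
      calc ∑ y, H x y * w y = ∑ y, ∑ k, (∑ z, s z * g k z * w z) * (H x y * g k y) := by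
            refine Finset.sum_congr rfl fun y _ => ?_
            rw [hexp w y, Finset.mul_sum]
            refine Finset.sum_congr rfl fun k _ => ?_
            ring
        _ = _ := by
            rw [Finset.sum_comm]
            refine Finset.sum_congr rfl fun k _ => ?_
            rw [← Finset.mul_sum, hg]
    simp only [bform, h1, Finset.mul_sum]
    rw [Finset.sum_comm]
    refine Finset.sum_congr rfl fun k _ => ?_
    rw [sq, ← mul_assoc, Finset.mul_sum]
    refine Finset.sum_congr rfl fun x _ => ?_
    ring
  rw [hww]
  refine Finset.sum_nonpos fun k _ => ?_
  rcases le_or_gt (l k) 0 with hl | hl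
  · exact mul_nonpos_of_nonpos_of_nonneg hl (sq_nonneg _)
  suffices h : ∑ y, s y * g k y * w y = 0 by simp [h]
  exact weighted_sum_eigenvector_eq_zero hH hpos ha o hrow hspos hds hl (hg k) (hstar _) hw

/-- A square of a linear form minus a sum of squares satisfies the reversed Cauchy–Schwarz
inequality. -/
lemma bform_mul_le_sq_of_eq_sub {κ : Type*} [Fintype κ] {H : n → n → ℝ} (u : n → ℝ)
    (b : κ → n → ℝ) (hH : ∀ x y, H x y = u x * u y - ∑ q, b q x * b q y) {a : n → ℝ}
    (ha : 0 ≤ bform H a a) (hua : ∑ x, u x * a x ≠ 0) (v : n → ℝ) :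
    bform H a a * bform H v v ≤ bform H a v ^ 2 := by
  have hsymm : ∀ x y, H x y = H y x := fun x y => by
    rw [hH, hH, mul_comm]
    simp only [mul_comm]
  have hself : ∀ w, bform H w w = (∑ x, u x * w x) ^ 2 - ∑ q, (∑ x, b q x * w x) ^ 2 := by
    intro w
    have h1 : ∑ q, (∑ x, b q x * w x) ^ 2 = ∑ x, ∑ y, w x * ((∑ q, b q x * b q y) * w y) := by
      simp only [sq, Finset.sum_mul, Finset.mul_sum]
      rw [Finset.sum_comm]
      refine Finset.sum_congr rfl fun x _ => ?_
      rw [Finset.sum_comm]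
      exact Finset.sum_congr rfl fun y _ => Finset.sum_congr rfl fun q _ => by ring
    rw [h1, sq, Finset.sum_mul_sum]
    simp only [bform, hH, Finset.mul_sum, ← Finset.sum_sub_distrib]
    exact Finset.sum_congr rfl fun x _ => Finset.sum_congr rfl fun y _ => by ring
  refine bform_mul_le_sq hsymm ha (t := -((∑ x, u x * v x) / ∑ x, u x * a x)) ?_
  rw [hself]
  have h0 : ∑ x, u x * (v x + -((∑ x, u x * v x) / ∑ x, u x * a x) * a x) = 0 := by
    simp only [mul_add, Finset.sum_add_distrib, mul_left_comm (u _), ← Finset.mul_sum]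
    field_simp
    ring
  rw [h0]
  have := Finset.sum_nonneg fun q (_ : q ∈ Finset.univ) =>
    sq_nonneg (∑ x, b q x * (v x + -((∑ x, u x * v x) / ∑ x, u x * a x) * a x))
  linarith

end WeightedForms

section IndependencePolynomial

variable {α : Type*}

/-- The evaluation point: `ε` in the homogenizing variable and `1` elsewhere. -/
def evalPoint (ε : ℝ) : Option α → ℝ
  | none => ε
  | some _ => 1

lemma evalPoint_pos {ε : ℝ} (hε : 0 < ε) (x : Option α) : 0 < evalPoint ε x := by
  cases x
  exacts [hε, one_pos]

variable [DecidableEq α]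

lemma indep_of_indep_insert {M : Matroid α} (S : Finset α) (i : α)
    (h : M.Indep (insert i S : Finset α)) :
    M.Indep (S : Set α) :=
  h.subset (by simp)

/-- Being parallel is a transitive relation in contractions. -/
lemma not_indep_insert_trans {M : Matroid α} {S : Finset α} {i j k : α}
    (hj : M.Indep (insert j S : Finset α)) (hjS : j ∉ S) (hiS : i ∉ S) (hkS : k ∉ S)
    (hij : i = j ∨ ¬ M.Indep (insert i (insert j S) : Finset α))
    (hjk : j = k ∨ ¬ M.Indep (insert j (insert k S) : Finset α)) :
    i = k ∨ ¬ M.Indep (insert i (insert k S) : Finset α) := by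
  rcases hij with rfl | hij
  · exact hjk
  rcases hjk with rfl | hjk
  · exact .inr hij
  by_contra! h
  obtain ⟨e, he, heS, hind⟩ := hj.augment_finset h.2 (by
    rw [Finset.card_insert_of_notMem hjS, Finset.card_insert_of_notMem,
      Finset.card_insert_of_notMem hkS]
    · omega
    · simp [h.1, hiS])
  simp only [Finset.mem_insert, not_or] at he heS
  rcases he with rfl | rfl | he
  · exact hij (by simpa using hind)
  · refine hjk ?_
    rw [Finset.insert_comm]
    simpa using hind
  · exact heS.2 he

/-- Partial derivatives of a function on finite sets, viewed as the table of the iterated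
derivatives at a point of a polynomial which is affine in each variable `some i`, and whose
derivative in the variable `none` has been accounted for in the function itself. -/
def setDeriv : Option α → (Finset α → ℝ) → Finset α → ℝ
  | none, φ, S => φ S
  | some i, φ, S => if i ∈ S then 0 else φ (insert i S)

lemma setDeriv_comm (x y : Option α) (φ : Finset α → ℝ) :
    setDeriv x (setDeriv y φ) = setDeriv y (setDeriv x φ) := by
  funext S
  cases x <;> cases y <;> simp only [setDeriv]
  rename_i i j
  by_cases hi : i ∈ S <;> by_cases hj : j ∈ S <;> by_cases hij : i = j <;>
    simp [hi, hj, hij, Ne.symm, Finset.insert_comm]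

lemma setDeriv_sum {κ : Type*} (s : Finset κ) (x : Option α) (c : κ → ℝ)
    (φ : κ → Finset α → ℝ) :
    setDeriv x (fun S => ∑ k ∈ s, c k * φ k S) = fun S => ∑ k ∈ s, c k * setDeriv x (φ k) S := by
  funext S
  cases x <;> simp only [setDeriv]
  split_ifs <;> simp

lemma setDeriv_nonneg {φ : Finset α → ℝ} (hφ : ∀ S, 0 ≤ φ S) (x : Option α) (S : Finset α) :
    0 ≤ setDeriv x φ S := by
  cases x <;> simp only [setDeriv]
  · exact hφ S
  · split_ifs
    exacts [le_rfl, hφ _]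

lemma setDeriv_eq_zero {φ : Finset α → ℝ} {p : Finset α → Prop} (hφ : ∀ S, ¬ p S → φ S = 0)
    (hp : ∀ S i, p (insert i S) → p S) (x : Option α) {S : Finset α} (hS : ¬ p S) :
    setDeriv x φ S = 0 := by
  cases x <;> simp only [setDeriv]
  · exact hφ S hS
  · split_ifs
    exacts [rfl, hφ _ fun h => hS (hp _ _ h)]

variable [Fintype α]

open Classical in
/-- The value at `S` is the `S`-th derivative, at the point `evalPoint ε`, of `m !` times the
homogenized generating polynomial `∑ ε ^ (m - #(I \ S)) / (m - #(I \ S))! * x ^ (I \ S)` of the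
independent sets `I ⊇ S` with at most `m` elements outside `S`. It is defined through the Euler
relation. -/
noncomputable def indepGen (M : Matroid α) (ε : ℝ) : ℕ → Finset α → ℝ
  | 0, S => if M.Indep (S : Set α) then 1 else 0
  | m + 1, S => ∑ x : Option α, evalPoint ε x * setDeriv x (indepGen M ε m) S

lemma setDeriv_indepGen_succ (M : Matroid α) (ε : ℝ) (m : ℕ) (x : Option α) :
    setDeriv x (indepGen M ε (m + 1)) =
      fun S => ∑ z, evalPoint ε z * setDeriv z (setDeriv x (indepGen M ε m)) S := by
  have : indepGen M ε (m + 1) =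
    fun S => ∑ z, evalPoint ε z * setDeriv z (indepGen M ε m) S := rfl
  rw [this, setDeriv_sum]
  simp only [setDeriv_comm x]

lemma setDeriv_setDeriv_indepGen_succ (M : Matroid α) (ε : ℝ) (m : ℕ) (x y : Option α) :
    setDeriv x (setDeriv y (indepGen M ε (m + 1))) =
      fun S => ∑ z, evalPoint ε z * setDeriv z (setDeriv x (setDeriv y (indepGen M ε m))) S := by
  rw [setDeriv_indepGen_succ, setDeriv_sum]
  simp only [setDeriv_comm x]

variable {M : Matroid α} {ε : ℝ}

lemma indepGen_nonneg (hε : 0 < ε) (m : ℕ) (S : Finset α) : 0 ≤ indepGen M ε m S := by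
  induction m generalizing S with
  | zero => simp only [indepGen]; split_ifs <;> simp
  | succ m ih =>
    exact Finset.sum_nonneg fun x _ => mul_nonneg (evalPoint_pos hε x).le (setDeriv_nonneg ih x S)

lemma indepGen_eq_zero (m : ℕ) (S : Finset α) (hS : ¬ M.Indep (S : Set α)) :
    indepGen M ε m S = 0 := by
  induction m generalizing S with
  | zero => simp [indepGen, hS]
  | succ m ih =>
    refine Finset.sum_eq_zero fun x _ => ?_
    rw [setDeriv_eq_zero (p := fun S : Finset α => M.Indep (S : Set α)) ih
      indep_of_indep_insert x hS, mul_zero]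

lemma indepGen_pos (hε : 0 < ε) (m : ℕ) (S : Finset α) (hS : M.Indep (S : Set α)) :
    0 < indepGen M ε m S := by
  induction m with
  | zero => simp [indepGen, hS]
  | succ m ih =>
    exact Finset.sum_pos' (fun x _ => mul_nonneg (evalPoint_pos hε x).le
      (setDeriv_nonneg (indepGen_nonneg hε m) x S)) ⟨none, Finset.mem_univ _, mul_pos hε ih⟩

/-- Vanishing of a first derivative forces the vanishing of all further derivatives. -/
lemma setDeriv_eq_zero_of_setDeriv_indepGen_eq_zero (hε : 0 < ε) {m : ℕ} {S : Finset α}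
    {x : Option α} (hx : setDeriv x (indepGen M ε m) S = 0) {φ : Finset α → ℝ}
    (hφ : ∀ S : Finset α, ¬ M.Indep (S : Set α) → φ S = 0) : setDeriv x φ S = 0 := by
  cases x with
  | none => exact hφ S fun h => (indepGen_pos hε m S h).ne' hx
  | some i =>
    simp only [setDeriv] at hx ⊢
    split_ifs at hx ⊢ with hi
    · rfl
    · exact hφ _ fun h => (indepGen_pos hε m _ h).ne' hx

lemma bform_indepGen_zero_mul_le_sq (hε : 0 < ε) (S : Finset α) (v : Option α → ℝ) :
    bform (fun x y => setDeriv x (setDeriv y (indepGen M ε 0)) S) (evalPoint ε) (evalPoint ε) *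
      bform (fun x y => setDeriv x (setDeriv y (indepGen M ε 0)) S) v v ≤
      bform (fun x y => setDeriv x (setDeriv y (indepGen M ε 0)) S) (evalPoint ε) v ^ 2 := by
  classical
  have hnn : ∀ x y, 0 ≤ setDeriv x (setDeriv y (indepGen M ε 0)) S := fun x y =>
    setDeriv_nonneg (setDeriv_nonneg (indepGen_nonneg hε 0) y) x S
  have haa : 0 ≤ bform (fun x y => setDeriv x (setDeriv y (indepGen M ε 0)) S)
      (evalPoint ε) (evalPoint ε) :=
    Finset.sum_nonneg fun x _ => mul_nonneg (evalPoint_pos hε x).le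
      (Finset.sum_nonneg fun y _ => mul_nonneg (hnn x y) (evalPoint_pos hε y).le)
  by_cases hS : M.Indep (S : Set α)
  swap
  · have h0 : ∀ x y, setDeriv x (setDeriv y (indepGen M ε 0)) S = 0 := fun x y =>
      setDeriv_eq_zero (p := fun S : Finset α => M.Indep (S : Set α))
        (fun T hT => setDeriv_eq_zero (p := fun S : Finset α => M.Indep (S : Set α))
          (indepGen_eq_zero 0) indep_of_indep_insert y hT) indep_of_indep_insert x hS
    simp [h0, bform]
  let P : α → Prop := fun i => i ∉ S ∧ M.Indep (insert i S : Finset α)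
  let R : α → α → Prop := fun i j => i = j ∨ ¬ M.Indep (insert i (insert j S) : Finset α)
  have Rsymm : ∀ i j, R i j → R j i := by
    rintro i j (h | h)
    · exact .inl h.symm
    · exact .inr (by rwa [Finset.insert_comm])
  let c : α → Finset α := fun i => Finset.univ.filter fun k => P k ∧ R i k
  have hc : ∀ i j, P i → P j → (c i = c j ↔ R i j) := by
    intro i j hi hj
    constructor
    · intro h
      have : j ∈ c i := by rw [h]; simp [c, hj, R]
      exact (Finset.mem_filter.1 this).2.2
    · intro h
      ext k
      simp only [c, Finset.mem_filter, Finset.mem_univ, true_and]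
      refine and_congr_right fun hk => ⟨fun h' => ?_, fun h' => ?_⟩
      · exact not_indep_insert_trans hi.2 hi.1 hj.1 hk.1 (Rsymm _ _ h) h'
      · exact not_indep_insert_trans hj.2 hj.1 hi.1 hk.1 h h'
  let u : Option α → ℝ := fun x => setDeriv x (indepGen M ε 0) S
  have hu : ∀ i, u (some i) = if P i then 1 else 0 := by
    intro i
    by_cases hi : i ∈ S <;> simp [u, P, setDeriv, indepGen, hi]
  have huo : u none = 1 := by simp [u, setDeriv, indepGen, hS]
  let b : Finset α → Option α → ℝ := fun q x => x.elim 0 fun i => if q = c i then u (some i) else 0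
  refine bform_mul_le_sq_of_eq_sub u b ?_ haa ?_ v
  · intro x y
    cases x with
    | none => simp [b, huo]; rfl
    | some i =>
      cases y with
      | none => simp [b, huo]; rfl
      | some j =>
        have hsum : ∑ q, b q (some i) * b q (some j) =
            if c i = c j then u (some i) * u (some j) else 0 := by
          rw [if_congr (eq_comm (a := c i)) rfl rfl]
          simp [b]
        rw [hsum, hu, hu]
        by_cases hi : P i
        · by_cases hj : P j
          · have hiS := hi.1
            have hjS := hj.1
            simp only [hc i j hi hj, hi, hj, if_true, setDeriv, indepGen, hiS, if_false, R]
            by_cases hij : i = j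
            · simp [hij]
            · have hji : j ≠ i := Ne.symm hij
              rw [Finset.insert_comm i j]
              by_cases h : M.Indep (insert j (insert i S) : Finset α)
              · simp only [Finset.mem_insert, hji, hjS, or_self, if_false, h, hij]; norm_num
              · simp only [Finset.mem_insert, hji, hjS, or_self, if_false, h, hij]; norm_num
          · have : setDeriv (some j) (setDeriv (some i) (indepGen M ε 0)) S = 0 :=
              setDeriv_eq_zero_of_setDeriv_indepGen_eq_zero (m := 0) hε
                (by have := hu j; simpa [hj, u] using this)
                fun T hT => setDeriv_eq_zero (p := fun S : Finset α => M.Indep (S : Set α))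
                  (indepGen_eq_zero 0) indep_of_indep_insert _ hT
            rw [setDeriv_comm, this]; simp [hj]
        · have : setDeriv (some i) (setDeriv (some j) (indepGen M ε 0)) S = 0 :=
            setDeriv_eq_zero_of_setDeriv_indepGen_eq_zero (m := 0) hε
              (by have := hu i; simpa [hi, u] using this)
              fun T hT => setDeriv_eq_zero (p := fun S : Finset α => M.Indep (S : Set α))
                (indepGen_eq_zero 0) indep_of_indep_insert _ hT
          rw [this]; simp [hi]
  · refine (Finset.sum_pos' (fun x _ => mul_nonneg ?_ (evalPoint_pos hε x).le)
      ⟨none, Finset.mem_univ _, ?_⟩).ne'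
    · exact setDeriv_nonneg (indepGen_nonneg hε 0) x S
    · rw [huo, one_mul]; exact hε

lemma bform_indepGen_mul_le_sq (hε : 0 < ε) (m : ℕ) (S : Finset α) (v : Option α → ℝ) :
    bform (fun x y => setDeriv x (setDeriv y (indepGen M ε m)) S) (evalPoint ε) (evalPoint ε) *
      bform (fun x y => setDeriv x (setDeriv y (indepGen M ε m)) S) v v ≤
      bform (fun x y => setDeriv x (setDeriv y (indepGen M ε m)) S) (evalPoint ε) v ^ 2 := by
  induction m generalizing S v with
  | zero => exact bform_indepGen_zero_mul_le_sq hε S v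
  | succ m ih =>
    have hvan : ∀ (m : ℕ) (y : Option α) (T : Finset α), ¬ M.Indep (T : Set α) →
        setDeriv y (indepGen M ε m) T = 0 := fun m y T hT =>
      setDeriv_eq_zero (p := fun S : Finset α => M.Indep (S : Set α))
        (indepGen_eq_zero m) indep_of_indep_insert y hT
    have hvan2 : ∀ (x y : Option α) (T : Finset α), ¬ M.Indep (T : Set α) →
        setDeriv x (setDeriv y (indepGen M ε m)) T = 0 := fun x y T hT =>
      setDeriv_eq_zero (p := fun S : Finset α => M.Indep (S : Set α))
        (hvan m y) indep_of_indep_insert x hT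
    have hH : ∀ x y, setDeriv x (setDeriv y (indepGen M ε (m + 1))) S =
        ∑ z, setDeriv x (setDeriv y (setDeriv z (indepGen M ε m))) S * evalPoint ε z := by
      intro x y
      rw [setDeriv_setDeriv_indepGen_succ]
      refine Finset.sum_congr rfl fun z _ => ?_
      rw [setDeriv_comm z x, setDeriv_comm z y, mul_comm]
    refine bform_mul_le_sq_of_local (fun x y => by rw [setDeriv_comm])
      (fun x y => setDeriv_nonneg (setDeriv_nonneg (indepGen_nonneg hε _) y) x S)
      (evalPoint_pos hε) none (fun x hx y => ?_)
      (fun z v => bform (fun x y => setDeriv z (setDeriv x (setDeriv y (indepGen M ε m))) S) v v)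
      (fun v => ?_) (fun x hx v => ?_) (fun x v => ?_) v
    · exact setDeriv_eq_zero_of_setDeriv_indepGen_eq_zero hε hx (hvan _ y)
    · simp only [bform, setDeriv_setDeriv_indepGen_succ, Finset.mul_sum, Finset.sum_mul]
      rw [Finset.sum_comm_cycle]
      exact Finset.sum_congr rfl fun z _ => Finset.sum_congr rfl fun x _ =>
        Finset.sum_congr rfl fun y _ => by ring
    · have : ∀ y z, setDeriv x (setDeriv y (setDeriv z (indepGen M ε m))) S = 0 := fun y z =>
        setDeriv_eq_zero_of_setDeriv_indepGen_eq_zero hε hx (hvan2 y z)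
      simp [bform, this]
    · have hform : ∀ w : Option α → ℝ, ∑ y, setDeriv x (setDeriv y (indepGen M ε (m + 1))) S * w y =
          bform (fun y z => setDeriv x (setDeriv y (setDeriv z (indepGen M ε m))) S)
            (evalPoint ε) w := by
        intro w
        rw [bform_comm fun y z => by rw [setDeriv_comm y z]]
        refine Finset.sum_congr rfl fun y _ => ?_
        rw [hH, mul_comm]
      rw [hform, hform]
      cases x with
      | none => exact ih S v
      | some i =>
        by_cases hi : i ∈ S
        · simp [setDeriv, hi, bform]
        · simpa only [setDeriv, hi, if_false] using ih (insert i S) v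

lemma indepGen_mul_le_sq (hε : 0 < ε) (m : ℕ) (S : Finset α) :
    indepGen M ε (m + 2) S * indepGen M ε m S ≤ indepGen M ε (m + 1) S ^ 2 := by
  have hrow : ∀ x, ∑ y, setDeriv x (setDeriv y (indepGen M ε m)) S * evalPoint ε y =
      setDeriv x (indepGen M ε (m + 1)) S := by
    intro x
    rw [setDeriv_indepGen_succ]
    exact Finset.sum_congr rfl fun y _ => by rw [setDeriv_comm, mul_comm]
  have h := bform_indepGen_mul_le_sq (M := M) hε m S fun x => x.elim 1 fun _ => 0
  rw [bform_comm (fun x y => by rw [setDeriv_comm]) (evalPoint ε) fun x => x.elim 1 fun _ => 0] at h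
  simp only [bform, hrow] at h
  simpa [setDeriv, indepGen] using h

lemma continuous_indepGen (m : ℕ) (S : Finset α) : Continuous fun ε => indepGen M ε m S := by
  induction m generalizing S with
  | zero => exact continuous_const
  | succ m ih =>
    refine continuous_finsetSum _ fun x _ => ?_
    cases x with
    | none => exact continuous_id.mul (ih S)
    | some i =>
      refine continuous_const.mul ?_
      by_cases hi : i ∈ S <;> simp only [setDeriv, hi, if_true, if_false]
      exacts [continuous_const, ih _]

open Classical in
/-- The number of independent sets containing `S` with exactly `m` elements outside `S`. -/
noncomputable def indepExtCount (M : Matroid α) (S : Finset α) (m : ℕ) : ℕ :=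
  (Finset.univ.filter fun I : Finset α => M.Indep (I : Set α) ∧ S ⊆ I ∧ I.card = S.card + m).card

lemma sum_indepExtCount_insert (M : Matroid α) (S : Finset α) (m : ℕ) :
    ∑ i, (if i ∈ S then 0 else indepExtCount M (insert i S) m) =
      (m + 1) * indepExtCount M S (m + 1) := by
  classical
  have h1 : ∀ i, (if i ∈ S then 0 else indepExtCount M (insert i S) m) =
      ∑ I : Finset α, if (M.Indep (I : Set α) ∧ S ⊆ I ∧ I.card = S.card + (m + 1)) ∧ i ∈ I \ S
        then 1 else 0 := by
    intro i
    by_cases hi : i ∈ S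
    · simp [hi]
    · simp only [hi, if_false, indepExtCount, Finset.card_filter, Finset.card_insert_of_notMem hi]
      refine Finset.sum_congr rfl fun I _ => if_congr ?_ rfl rfl
      simp only [Finset.insert_subset_iff, Finset.mem_sdiff, hi, not_false_eq_true, and_true,
        add_assoc, add_comm 1 m]
      tauto
  simp only [h1]
  rw [Finset.sum_comm, indepExtCount, Finset.card_filter, Finset.mul_sum]
  refine Finset.sum_congr rfl fun I _ => ?_
  by_cases hI : M.Indep (I : Set α) ∧ S ⊆ I ∧ I.card = S.card + (m + 1)
  · have hcard : (I \ S).card = m + 1 := by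
      rw [Finset.card_sdiff_of_subset hI.2.1, hI.2.2]; omega
    rw [if_pos hI, mul_one]
    simp only [and_iff_right hI, Finset.sum_boole, Finset.filter_univ_mem, Nat.cast_id, hcard]
  · simp [hI]

lemma indepGen_zero (m : ℕ) (S : Finset α) :
    indepGen M 0 m S = m.factorial * indepExtCount M S m := by
  classical
  induction m generalizing S with
  | zero =>
    have h : (Finset.univ.filter fun I : Finset α => M.Indep (I : Set α) ∧ S ⊆ I ∧
        I.card = S.card + 0) = if M.Indep (S : Set α) then {S} else ∅ := by
      ext I
      have : (S ⊆ I ∧ I.card = S.card + 0) ↔ I = S :=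
        ⟨fun h => (Finset.eq_of_subset_of_card_le h.1 h.2.le).symm, by rintro rfl; simp⟩
      split_ifs with hS <;> simp only [Finset.mem_filter, this] <;> aesop
    rw [indepExtCount, h]
    split_ifs with hS <;> simp [indepGen, hS]
  | succ m ih =>
    have h := congrArg (Nat.cast (R := ℝ)) (sum_indepExtCount_insert M S m)
    push_cast at h
    rw [indepGen, Fintype.sum_option, Nat.factorial_succ]
    push_cast
    rw [mul_right_comm, ← h, Finset.sum_mul]
    simp only [evalPoint, setDeriv, zero_mul, zero_add, one_mul]
    refine Finset.sum_congr rfl fun i _ => ?_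
    split_ifs
    · simp
    · rw [ih, mul_comm]

lemma indepExtCount_empty (M : Matroid α) (m : ℕ) : indepExtCount M ∅ m = indepCount M m := by
  classical
  rw [indepCount, indepExtCount, ← Set.ncard_coe_finset,
    ← Set.ncard_image_of_injective _ Finset.coe_injective]
  congr 1
  ext I
  simp only [Set.mem_image, Finset.coe_filter, Finset.mem_univ, true_and, Set.mem_ofPred_eq,
    Finset.empty_subset, Finset.card_empty, zero_add]
  constructor
  · rintro ⟨J, hJ, rfl⟩
    simpa using hJ
  · intro hI
    refine ⟨I.toFinite.toFinset, ?_, I.toFinite.coe_toFinset⟩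
    rwa [I.toFinite.coe_toFinset, ← Set.ncard_eq_toFinset_card]

end IndependencePolynomial

/-- **Log-concavity of the f-vector of the independence complex.**
If `M` is a matroid of rank `d` on a finite ground set and `f_k` denotes the number of
independent sets of `M` of cardinality `k`, then `f_{k-1} f_{k+1} ≤ f_k ^ 2` for all
`0 < k < d`. -/
theorem fvector_independence_logConcave {α : Type*} [Fintype α] (M : Matroid α)
    (hE : M.E = Set.univ) (d : ℕ) (hrank : matroidRank M Set.univ = d) :
    ∀ k : ℕ, 0 < k → k < d →
      indepCount M (k - 1) * indepCount M (k + 1) ≤ indepCount M k ^ 2 := by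
  classical
  intro k hk _
  obtain ⟨m, rfl⟩ : ∃ m, k = m + 1 := ⟨k - 1, by omega⟩
  have hlim : indepGen M 0 (m + 2) ∅ * indepGen M 0 m ∅ ≤ indepGen M 0 (m + 1) ∅ ^ 2 := by
    have hc : ∀ j, Filter.Tendsto (fun ε => indepGen M ε j ∅) (nhdsWithin 0 (Set.Ioi 0))
        (nhds (indepGen M 0 j ∅)) := fun j =>
      (continuous_indepGen j ∅).continuousAt.tendsto.mono_left nhdsWithin_le_nhds
    refine le_of_tendsto_of_tendsto ((hc _).mul (hc _)) ((hc _).pow 2) ?_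
    filter_upwards [self_mem_nhdsWithin] with ε hε using indepGen_mul_le_sq hε m ∅
  simp only [indepGen_zero, indepExtCount_empty] at hlim
  rw [Nat.add_sub_cancel]
  have hnat : (m + 2).factorial * indepCount M (m + 2) * (m.factorial * indepCount M m) ≤
      ((m + 1).factorial * indepCount M (m + 1)) ^ 2 := by exact_mod_cast hlim
  have hpos : 0 < (m + 1) * m.factorial ^ 2 := by positivity
  have h : (m + 2) * (indepCount M m * indepCount M (m + 2)) ≤
      (m + 1) * indepCount M (m + 1) ^ 2 := by
    refine le_of_mul_le_mul_left ?_ hpos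
    simp only [Nat.factorial_succ] at hnat
    linarith
  refine le_of_mul_le_mul_left (h.trans ?_) (show 0 < m + 2 by omega)
  exact Nat.mul_le_mul_right _ (by omega)
end

section
/- Let E be a finite set with n+1 elements. The number of bipermutations of E, i.e., bisequences on E with exactly 2n+1 parts, is (2n+2)!/2^{n+1}. -/
/-- A bisequence on a finite set `E` (here, a finite type `α`), presented as a function
`B : Fin m → Finset α` recording its sequence of `m` parts: every part is nonempty, every
element of `E` appears in at least one part, every element appears in at most two parts,
and some element appears in exactly one part. -/
def IsBisequence {α : Type*} [Fintype α] [DecidableEq α] {m : ℕ} (B : Fin m → Finset α) :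
    Prop :=
  (∀ i, (B i).Nonempty) ∧
  (∀ e : α, ∃ i, e ∈ B i) ∧
  (∀ e : α, (Finset.univ.filter fun i => e ∈ B i).card ≤ 2) ∧
  (∃ e : α, (Finset.univ.filter fun i => e ∈ B i).card = 1)

/-- Two functions with equinumerous fibers differ by a permutation of the domain. -/
theorem exists_perm_comp_eq_of_ncard_fiber_eq {ι α : Type*} [Finite ι] {f g : ι → α}
    (h : ∀ a, {i | f i = a}.ncard = {i | g i = a}.ncard) : ∃ σ : Equiv.Perm ι, g ∘ σ = f := by
  have e : ∀ a, {i // f i = a} ≃ {i // g i = a} := fun a => (Finite.card_eq.mp (h a)).some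
  refine ⟨(Equiv.sigmaFiberEquiv f).symm.trans
    ((Equiv.sigmaCongrRight e).trans (Equiv.sigmaFiberEquiv g)), funext fun i => ?_⟩
  exact (e (f i) ⟨i, rfl⟩).2

/-- The number of functions with the same fiber cardinalities as `g`. -/
theorem ncard_fiber_eq_mul_prod_factorial {ι α : Type*} [Finite ι] [Fintype α] (g : ι → α) :
    {f : ι → α | ∀ a, {i | f i = a}.ncard = {i | g i = a}.ncard}.ncard *
      ∏ a, ({i | g i = a}.ncard).factorial = (Nat.card ι).factorial := by
  have horbit : {f : ι → α | ∀ a, {i | f i = a}.ncard = {i | g i = a}.ncard} =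
      MulAction.orbit (Equiv.Perm ι)ᵈᵐᵃ g := by
    ext f
    constructor
    · intro hf
      obtain ⟨σ, rfl⟩ := exists_perm_comp_eq_of_ncard_fiber_eq hf
      exact ⟨DomMulAct.mk σ, rfl⟩
    · rintro ⟨σ, rfl⟩ a
      exact Set.ncard_congr' ((DomMulAct.mk.symm σ).subtypeEquiv fun _ => Iff.rfl)
  have hstab : Nat.card (MulAction.stabilizer (Equiv.Perm ι)ᵈᵐᵃ g) =
      ∏ a, ({i | g i = a}.ncard).factorial := by
    rw [← DomMulAct.stabilizer_ncard]
    exact (Nat.card_congr (DomMulAct.mk.subtypeEquiv fun _ => Iff.rfl)).symm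
  rw [horbit, ← hstab, ← MulAction.index_stabilizer, Subgroup.index_mul_card,
    ← Nat.card_perm]
  exact Nat.card_congr DomMulAct.mk.symm

/-- The number of functions all of whose fibers have two elements. -/
theorem ncard_fibers_two {ι α : Type*} [Fintype ι] [Fintype α] [DecidableEq α]
    (h : Fintype.card ι = 2 * Fintype.card α) :
    {f : ι → α | ∀ a, (Finset.univ.filter fun i => f i = a).card = 2}.ncard =
      (Fintype.card ι).factorial / 2 ^ Fintype.card α := by
  obtain ⟨e⟩ : Nonempty (ι ≃ α × Bool) := Fintype.card_eq.mp (by simp [h, mul_comm])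
  have hg : ∀ a, {i | (e i).1 = a}.ncard = 2 := by
    intro a
    rw [show {i | (e i).1 = a} = e ⁻¹' ({a} ×ˢ Set.univ) by ext; simp,
      Set.ncard_preimage_of_injective_subset_range e.injective (by simp), Set.ncard_prod]
    simp
  have key := ncard_fiber_eq_mul_prod_factorial fun i => (e i).1
  simp only [hg, Finset.prod_const, Nat.factorial_two, Finset.card_univ,
    Nat.card_eq_fintype_card] at key
  rw [← key, Nat.mul_div_cancel _ (by positivity)]
  simp [Set.ncard_eq_toFinset_card']

theorem card_filter_fin_succ_eq {α : Type*} [DecidableEq α] {m : ℕ} (f : Fin (m + 1) → α) (a : α) :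
    (Finset.univ.filter fun i => f i = a).card =
      (Finset.univ.filter fun i : Fin m => f i.castSucc = a).card +
        if f (Fin.last m) = a then 1 else 0 := by
  simp only [Finset.card_filter, Fin.sum_univ_castSucc]

/-- A bisequence of maximal length consists of singletons, and exactly one element
appears only once. -/
theorem IsBisequence.card_eq_one_and_exists {α : Type*} [Fintype α] [DecidableEq α] {n : ℕ}
    (hcard : Fintype.card α = n + 1) {B : Fin (2 * n + 1) → Finset α} (hB : IsBisequence B) :
    (∀ i, (B i).card = 1) ∧ ∃ e₀, (Finset.univ.filter fun i => e₀ ∈ B i).card = 1 ∧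
      ∀ e ≠ e₀, (Finset.univ.filter fun i => e ∈ B i).card = 2 := by
  obtain ⟨hne, -, hle, e₀, he₀⟩ := hB
  have hdouble : ∑ i, (B i).card = ∑ e, (Finset.univ.filter fun i => e ∈ B i).card := by
    simpa [Finset.bipartiteAbove, Finset.bipartiteBelow] using
      Finset.sum_card_bipartiteAbove_eq_sum_card_bipartiteBelow
        (s := Finset.univ) (t := Finset.univ) fun i e => e ∈ B i
  have hsplit := Finset.add_sum_erase Finset.univ
    (fun e => (Finset.univ.filter fun i => e ∈ B i).card) (Finset.mem_univ e₀)
  have hlower : ∑ _i : Fin (2 * n + 1), 1 ≤ ∑ i, (B i).card :=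
    Finset.sum_le_sum fun i _ => (hne i).card_pos
  have hupper : ∑ e ∈ Finset.univ.erase e₀, (Finset.univ.filter fun i => e ∈ B i).card ≤
      ∑ _e ∈ Finset.univ.erase e₀, 2 := Finset.sum_le_sum fun e _ => hle e
  have hone : ∑ _i : Fin (2 * n + 1), 1 = 2 * n + 1 := by simp
  have htwo : ∑ _e ∈ Finset.univ.erase e₀, 2 = 2 * n := by
    simp [hcard, mul_comm]
  simp only [he₀] at hsplit
  refine ⟨fun i => ?_, e₀, he₀, fun e he => ?_⟩
  · have heq : ∑ _i : Fin (2 * n + 1), 1 = ∑ i, (B i).card := by omega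
    exact ((Finset.sum_eq_sum_iff_of_le fun i _ => (hne i).card_pos).mp
      heq i (Finset.mem_univ i)).symm
  · have heq : ∑ e ∈ Finset.univ.erase e₀, (Finset.univ.filter fun i => e ∈ B i).card =
        ∑ _e ∈ Finset.univ.erase e₀, 2 := by omega
    exact (Finset.sum_eq_sum_iff_of_le fun e _ => hle e).mp heq e (by simp [he])

theorem setOf_isBisequence_eq_image {α : Type*} [Fintype α] [DecidableEq α] {n : ℕ}
    (hcard : Fintype.card α = n + 1) :
    {B : Fin (2 * n + 1) → Finset α | IsBisequence B} =
      (fun (f : Fin (2 * n + 1 + 1) → α) i => {f i.castSucc}) ''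
        {f | ∀ a, (Finset.univ.filter fun i => f i = a).card = 2} := by
  ext B
  constructor
  · intro hB
    obtain ⟨hone, e₀, he₀, htwo⟩ := hB.card_eq_one_and_exists hcard
    choose b hb using fun i => Finset.card_eq_one.mp (hone i)
    obtain rfl : B = fun i => {b i} := funext hb
    refine ⟨Fin.snoc b e₀, fun a => ?_, by simp⟩
    rw [card_filter_fin_succ_eq]
    simp only [Finset.mem_singleton, Fin.snoc_castSucc, Fin.snoc_last] at *
    by_cases ha : a = e₀
    · subst ha
      simp only [eq_comm (a := a)] at he₀
      simp [he₀]
    · have htwo := htwo a ha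
      simp only [eq_comm (a := a)] at htwo
      simp [htwo, Ne.symm ha]
  · rintro ⟨f, hf, rfl⟩
    replace hf := fun e => (card_filter_fin_succ_eq f e).symm.trans (hf e)
    have hf' : ∀ e, (Finset.univ.filter fun i : Fin (2 * n + 1) => e = f i.castSucc).card =
        (Finset.univ.filter fun i : Fin (2 * n + 1) => f i.castSucc = e).card := fun e => by
      simp only [eq_comm]
    refine ⟨fun i => Finset.singleton_nonempty _, fun e => ?_, fun e => ?_, f (Fin.last _), ?_⟩
    · have : 0 < (Finset.univ.filter fun i : Fin (2 * n + 1) => f i.castSucc = e).card := by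
        have := hf e
        grind
      obtain ⟨i, hi⟩ := Finset.card_pos.mp this
      exact ⟨i, by simpa [eq_comm] using hi⟩
    · simp only [Finset.mem_singleton, hf']
      have := hf e
      omega
    · simp only [Finset.mem_singleton, hf']
      have := hf (f (Fin.last _))
      grind

theorem injOn_singleton_castSucc {α : Type*} [DecidableEq α] (m : ℕ) :
    Set.InjOn (fun (f : Fin (m + 1) → α) (i : Fin m) => ({f i.castSucc} : Finset α))
      {f | ∀ a, (Finset.univ.filter fun i => f i = a).card = 2} := by
  intro f hf g hg hfg
  have hinit : ∀ i : Fin m, f i.castSucc = g i.castSucc := fun i =>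
    Finset.singleton_injective (congrFun hfg i)
  have h₁ := hf (f (Fin.last m))
  have h₂ := hg (f (Fin.last m))
  rw [card_filter_fin_succ_eq] at h₁ h₂
  simp only [hinit] at h₁
  funext i
  refine Fin.lastCases ?_ hinit i
  grind

/-- **The number of bipermutations.** If `|E| = n + 1`, then the number of bipermutations
of `E`, i.e. bisequences on `E` with exactly `2n+1` parts, is `(2n+2)!/2^{n+1}`. -/
theorem ncard_bipermutations {α : Type*} [Fintype α] [DecidableEq α] (n : ℕ)
    (hcard : Fintype.card α = n + 1) :
    {B : Fin (2 * n + 1) → Finset α | IsBisequence B}.ncard =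
      Nat.factorial (2 * n + 2) / 2 ^ (n + 1) := by
  rw [setOf_isBisequence_eq_image hcard, (injOn_singleton_castSucc _).ncard_image,
    ncard_fibers_two (by simp [hcard]; ring), hcard, Fintype.card_fin]
end

section
/- Let E be a finite set with n+1 elements, n ≥ 1. For a bisequence ℬ = (B_0, B_1, …, B_k) on E, set S_i = B_0 ∪ … ∪ B_{i−1} and T_i = B_i ∪ … ∪ B_k for 1 ≤ i ≤ k. Then: (1) the collection {S_i|T_i : 1 ≤ i ≤ k} is a flag of bisubsets of E; and (2) the assignment ℬ ↦ {S_i|T_i : 1 ≤ i ≤ k} is a bijection from the set of bisequences on E onto the set of flags of bisubsets in E. -/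
variable {α : Type*} [Fintype α] [DecidableEq α]

/-- A bisubset of a finite set `E` (here, a finite type `α`) is an ordered pair `S|T` of
nonempty subsets of `E` such that `S ∪ T = E` and `(S, T) ≠ (E, E)`. -/
def IsBisubset (p : Finset α × Finset α) : Prop :=
  p.1.Nonempty ∧ p.2.Nonempty ∧ p.1 ∪ p.2 = Finset.univ ∧ p ≠ (Finset.univ, Finset.univ)

/-- Two bisubsets `S|T` and `S'|T'` are comparable if `S ⊆ S'` and `T ⊇ T'`, or
`S ⊇ S'` and `T ⊆ T'`. -/
def BisubsetComparable (p q : Finset α × Finset α) : Prop :=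
  (p.1 ⊆ q.1 ∧ q.2 ⊆ p.2) ∨ (q.1 ⊆ p.1 ∧ p.2 ⊆ q.2)

/-- A flag of bisubsets (biflag) in `E`: a set of pairwise comparable bisubsets of `E`
such that the union of the intersections `S ∩ T` over its members `S|T` is not all
of `E`. -/
def IsBiflag (F : Finset (Finset α × Finset α)) : Prop :=
  (∀ p ∈ F, IsBisubset p) ∧ (∀ p ∈ F, ∀ q ∈ F, BisubsetComparable p q) ∧
  F.biUnion (fun p => p.1 ∩ p.2) ≠ Finset.univ

/-- A bisequence on `E`, presented as a nonempty list of parts: every part is nonempty,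
every element of `E` appears in at least one part, every element appears in at most two
parts, and some element appears in exactly one part. -/
def IsBisequenceList (L : List (Finset α)) : Prop :=
  L ≠ [] ∧ (∀ B ∈ L, B.Nonempty) ∧ (∀ e : α, ∃ B ∈ L, e ∈ B) ∧
  (∀ e : α, (L.filter fun B => decide (e ∈ B)).length ≤ 2) ∧
  (∃ e : α, (L.filter fun B => decide (e ∈ B)).length = 1)

/-- The flag of bisubsets associated to a bisequence `ℬ = (B_0, …, B_k)`: the set of
pairs `(S_i, T_i)` for `1 ≤ i ≤ k`, where `S_i = B_0 ∪ ⋯ ∪ B_{i-1}` and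
`T_i = B_i ∪ ⋯ ∪ B_k`. -/
def flagOfBisequence (L : List (Finset α)) : Finset (Finset α × Finset α) :=
  (Finset.Ioo 0 L.length).image fun i =>
    ((L.take i).foldr (· ∪ ·) ∅, (L.drop i).foldr (· ∪ ·) ∅)

/-- The sequence of parts on positions `0, …, k` in which each element `e` appears exactly at the
positions `a e` and `b e`. -/
def partsOf (k : ℕ) (a b : α → ℕ) : List (Finset α) :=
  (List.range (k + 1)).map fun i => Finset.univ.filter fun e => a e = i ∨ b e = i

/-- The number of members of `F` whose first component misses `e`. -/
def numFstMissing (F : Finset (Finset α × Finset α)) (e : α) : ℕ :=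
  (F.filter fun p => e ∉ p.1).card

/-- The number of members of `F` whose second component contains `e`. -/
def numSndContaining (F : Finset (Finset α × Finset α)) (e : α) : ℕ :=
  (F.filter fun p => e ∈ p.2).card

/-- The position of `p` in the chain of bisubsets `F`. -/
def bisubsetRank (F : Finset (Finset α × Finset α)) (p : Finset α × Finset α) : ℕ :=
  (F.filter fun q => q.1 ⊆ p.1 ∧ p.2 ⊆ q.2).card

theorem mem_foldr_union {β : Type*} [DecidableEq β] {L : List (Finset β)} {e : β} :
    e ∈ L.foldr (· ∪ ·) ∅ ↔ ∃ B ∈ L, e ∈ B := by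
  induction L with
  | nil => simp
  | cons B L ih => simp [ih]

theorem length_filter_range (n : ℕ) (P : ℕ → Prop) [DecidablePred P] :
    ((List.range n).filter fun i => decide (P i)).length = ((Finset.range n).filter P).card :=
  rfl

section PartsOf

variable {k : ℕ} {a b : α → ℕ}

theorem length_filter_partsOf (h : ∀ e, a e ≤ b e ∧ b e ≤ k) (e : α) :
    ((partsOf k a b).filter fun B => decide (e ∈ B)).length = ({a e, b e} : Finset ℕ).card := by
  have hf : ((partsOf k a b).filter fun B => decide (e ∈ B)).length =
      ((List.range (k + 1)).filter fun i => decide (a e = i ∨ b e = i)).length := by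
    simp [partsOf, List.filter_map, Function.comp_def]
  rw [hf, length_filter_range (k + 1) fun i => a e = i ∨ b e = i]
  congr 1
  ext i
  have := h e
  simp only [Finset.mem_filter, Finset.mem_range, Finset.mem_insert, Finset.mem_singleton]
  omega

theorem isBisequenceList_partsOf_iff (h : ∀ e, a e ≤ b e ∧ b e ≤ k) :
    IsBisequenceList (partsOf k a b) ↔
      (∀ i ≤ k, ∃ e, a e = i ∨ b e = i) ∧ ∃ e, a e = b e := by
  have hne : partsOf k a b ≠ [] := by simp [partsOf]
  have hcov : ∀ e, ∃ B ∈ partsOf k a b, e ∈ B := fun e =>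
    ⟨Finset.univ.filter fun x => a x = a e ∨ b x = a e,
      List.mem_map.2 ⟨a e, List.mem_range.2 (by have := h e; omega), rfl⟩, by simp⟩
  have htwo : ∀ e, ({a e, b e} : Finset ℕ).card ≤ 2 := fun e => Finset.card_le_two
  have hone : ∀ e, ({a e, b e} : Finset ℕ).card = 1 ↔ a e = b e := by
    intro e
    by_cases hab : a e = b e
    · simp [hab]
    · simp [Finset.card_pair hab, hab]
  have hparts : (∀ B ∈ partsOf k a b, B.Nonempty) ↔ ∀ i ≤ k, ∃ e, a e = i ∨ b e = i := by
    simp [partsOf, Finset.Nonempty]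
  simp only [IsBisequenceList, length_filter_partsOf h, hone, hparts]
  exact ⟨fun H => ⟨H.2.1, H.2.2.2.2⟩, fun H => ⟨hne, H.1, hcov, htwo, H.2⟩⟩

theorem flagOfBisequence_partsOf (h : ∀ e, a e ≤ b e ∧ b e ≤ k) :
    flagOfBisequence (partsOf k a b) = (Finset.Ioo 0 (k + 1)).image fun m =>
      (Finset.univ.filter fun e => a e < m, Finset.univ.filter fun e => m ≤ b e) := by
  have hlen : (partsOf k a b).length = k + 1 := by simp [partsOf]
  rw [flagOfBisequence, hlen]
  refine Finset.image_congr fun m hm => ?_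
  rw [Finset.mem_coe, Finset.mem_Ioo] at hm
  refine Prod.ext ?_ ?_
  · ext e
    have := h e
    simp only [mem_foldr_union, List.mem_take_iff_getElem, Finset.mem_filter, Finset.mem_univ,
      true_and, hlen]
    constructor
    · rintro ⟨B, ⟨i, hi, rfl⟩, he⟩
      simp [partsOf] at he
      omega
    · intro ha
      exact ⟨_, ⟨a e, by omega, rfl⟩, by simp [partsOf]⟩
  · ext e
    have := h e
    simp only [mem_foldr_union, List.mem_drop_iff_getElem, Finset.mem_filter, Finset.mem_univ,
      true_and, hlen]
    constructor
    · rintro ⟨B, ⟨i, hi, rfl⟩, he⟩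
      simp [partsOf] at he
      omega
    · intro hb
      refine ⟨_, ⟨b e - m, by omega, rfl⟩, ?_⟩
      simp [partsOf, Nat.add_sub_cancel' hb]

theorem injOn_lt_le {β : Type*} [Fintype β] {k : ℕ} {a b : β → ℕ}
    (hsurj : ∀ i ≤ k, ∃ e, a e = i ∨ b e = i) :
    Set.InjOn (fun m => ((Finset.univ.filter fun e => a e < m : Finset β),
      (Finset.univ.filter fun e => m ≤ b e : Finset β))) (Finset.Ioo 0 (k + 1)) := by
  have key : ∀ m m', m < m' → m' < k + 1 →
      ((Finset.univ.filter fun e => a e < m : Finset β),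
        (Finset.univ.filter fun e => m ≤ b e : Finset β)) ≠
      (Finset.univ.filter fun e => a e < m', Finset.univ.filter fun e => m' ≤ b e) := by
    intro m m' hlt hk heq
    obtain ⟨e, he⟩ := hsurj m (by omega)
    have h1 := Finset.ext_iff.1 (congrArg Prod.fst heq) e
    have h2 := Finset.ext_iff.1 (congrArg Prod.snd heq) e
    simp only [Finset.mem_filter, Finset.mem_univ, true_and] at h1 h2
    omega
  intro m hm m' hm' heq
  rw [Finset.mem_coe, Finset.mem_Ioo] at hm hm'
  rcases lt_trichotomy m m' with hlt | rfl | hlt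
  · exact absurd heq (key m m' hlt hm'.2)
  · rfl
  · exact absurd heq.symm (key m' m hlt hm.2)

theorem isBiflag_flagOfBisequence_partsOf (h : ∀ e, a e ≤ b e ∧ b e ≤ k)
    (hL : IsBisequenceList (partsOf k a b)) : IsBiflag (flagOfBisequence (partsOf k a b)) := by
  obtain ⟨hsurj, e₀, he₀⟩ := (isBisequenceList_partsOf_iff h).1 hL
  rw [flagOfBisequence_partsOf h]
  refine ⟨?_, ?_, ?_⟩
  · intro p hp
    obtain ⟨m, hm, rfl⟩ := Finset.mem_image.1 hp
    rw [Finset.mem_Ioo] at hm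
    refine ⟨?_, ?_, ?_, ?_⟩
    · obtain ⟨e, he⟩ := hsurj 0 (Nat.zero_le k)
      have := h e
      exact ⟨e, by simp; omega⟩
    · obtain ⟨e, he⟩ := hsurj k le_rfl
      have := h e
      exact ⟨e, by simp; omega⟩
    · ext e
      have := h e
      simp
      omega
    · intro heq
      have h1 := Finset.ext_iff.1 (congrArg Prod.fst heq) e₀
      have h2 := Finset.ext_iff.1 (congrArg Prod.snd heq) e₀
      simp at h1 h2
      omega
  · intro p hp q hq
    obtain ⟨m, -, rfl⟩ := Finset.mem_image.1 hp
    obtain ⟨m', -, rfl⟩ := Finset.mem_image.1 hq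
    rcases le_total m m' with hle | hle
    · left
      constructor <;> intro e <;> simp <;> omega
    · right
      constructor <;> intro e <;> simp <;> omega
  · intro heq
    have := Finset.ext_iff.1 heq e₀
    simp only [Finset.mem_biUnion, Finset.mem_image, Finset.mem_univ, iff_true] at this
    obtain ⟨p, ⟨m, -, rfl⟩, he⟩ := this
    simp at he
    omega

theorem partsOf_flagOfBisequence_partsOf (h : ∀ e, a e ≤ b e ∧ b e ≤ k)
    (hL : IsBisequenceList (partsOf k a b)) :
    partsOf (flagOfBisequence (partsOf k a b)).card
      (numFstMissing (flagOfBisequence (partsOf k a b)))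
      (numSndContaining (flagOfBisequence (partsOf k a b))) = partsOf k a b := by
  have hinj := injOn_lt_le ((isBisequenceList_partsOf_iff h).1 hL).1
  rw [flagOfBisequence_partsOf h]
  congr 1
  · rw [Finset.card_image_of_injOn hinj]
    simp
  · funext e
    have := h e
    rw [numFstMissing, Finset.filter_image,
      Finset.card_image_of_injOn (hinj.mono (Finset.coe_subset.2 (Finset.filter_subset _ _))),
      show (Finset.Ioo 0 (k + 1)).filter _ = Finset.Ioc 0 (a e) by ext; simp; omega,
      Nat.card_Ioc, Nat.sub_zero]
  · funext e
    have := h e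
    rw [numSndContaining, Finset.filter_image,
      Finset.card_image_of_injOn (hinj.mono (Finset.coe_subset.2 (Finset.filter_subset _ _))),
      show (Finset.Ioo 0 (k + 1)).filter _ = Finset.Ioc 0 (b e) by ext; simp; omega,
      Nat.card_Ioc, Nat.sub_zero]

end PartsOf

theorem Finset.mem_iff_eq_min'_or_eq_max' {s : Finset ℕ} (hs : s.Nonempty) (h2 : s.card ≤ 2)
    (i : ℕ) : i ∈ s ↔ s.min' hs = i ∨ s.max' hs = i := by
  constructor
  · intro hi
    by_contra! hne
    have hlt := (s.min'_le i hi).lt_of_ne hne.1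
    have hlt' := (s.le_max' i hi).lt_of_ne hne.2.symm
    have hsub : ({s.min' hs, i, s.max' hs} : Finset ℕ) ⊆ s := by
      simp [Finset.insert_subset_iff, hi, s.min'_mem, s.max'_mem]
    have := Finset.card_le_card hsub
    rw [Finset.card_eq_three.2 ⟨_, _, _, hlt.ne, (hlt.trans hlt').ne, hlt'.ne, rfl⟩] at this
    omega
  · rintro (rfl | rfl)
    · exact s.min'_mem hs
    · exact s.max'_mem hs

theorem IsBisequenceList.exists_eq_partsOf {L : List (Finset α)} (hL : IsBisequenceList L) :
    ∃ (k : ℕ) (a b : α → ℕ), (∀ e, a e ≤ b e ∧ b e ≤ k) ∧ L = partsOf k a b := by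
  obtain ⟨hne, -, hcov, htwo, -⟩ := hL
  have hLmap : L = (List.range L.length).map fun i => L.getD i ∅ := by
    apply List.ext_getElem <;> simp +contextual
  have hlen : 0 < L.length := List.length_pos_iff.2 hne
  let I : α → Finset ℕ := fun e => (Finset.range L.length).filter fun i => e ∈ L.getD i ∅
  have hI : ∀ e, (I e).Nonempty := by
    intro e
    obtain ⟨B, hB, he⟩ := hcov e
    obtain ⟨i, hi, rfl⟩ := List.mem_iff_getElem.1 hB
    exact ⟨i, by simp [I, hi, he]⟩
  have hI2 : ∀ e, (I e).card ≤ 2 := by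
    intro e
    have h2 := htwo e
    rw [hLmap, List.filter_map, List.length_map] at h2
    exact h2
  have hmem := fun e => Finset.mem_iff_eq_min'_or_eq_max' (hI e) (hI2 e)
  refine ⟨L.length - 1, fun e => (I e).min' (hI e), fun e => (I e).max' (hI e), ?_, ?_⟩
  · intro e
    refine ⟨Finset.min'_le_max' _ _, ?_⟩
    have := (Finset.mem_filter.1 ((I e).max'_mem (hI e))).1
    exact Nat.le_sub_one_of_lt (Finset.mem_range.1 this)
  · rw [partsOf, Nat.sub_add_cancel hlen]
    conv_lhs => rw [hLmap]
    refine List.map_congr_left fun i hi => ?_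
    ext e
    rw [Finset.mem_filter, ← hmem e i]
    simp [I, List.mem_range.1 hi]

section Biflag

variable {F : Finset (Finset α × Finset α)} {p q : Finset α × Finset α} {e : α}

theorem IsBiflag.mem_fst_iff (hF : IsBiflag F) (hp : p ∈ F) :
    e ∈ p.1 ↔ numFstMissing F e < bisubsetRank F p := by
  constructor
  · intro he
    refine Finset.card_lt_card (Finset.ssubset_iff_subset_ne.2 ⟨fun q hq => ?_, fun heq => ?_⟩)
    · rw [Finset.mem_filter] at hq ⊢
      rcases hF.2.1 p hp q hq.1 with hle | hle
      · exact absurd (hle.1 he) hq.2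
      · exact ⟨hq.1, hle⟩
    · have : p ∈ F.filter fun q => e ∉ q.1 := by simp [heq, hp]
      exact (Finset.mem_filter.1 this).2 he
  · intro hlt
    by_contra he
    refine absurd (Finset.card_le_card fun q hq => ?_) (not_le.2 hlt)
    rw [Finset.mem_filter] at hq ⊢
    exact ⟨hq.1, fun h => he (hq.2.1 h)⟩

theorem IsBiflag.mem_snd_iff (hF : IsBiflag F) (hp : p ∈ F) :
    e ∈ p.2 ↔ bisubsetRank F p ≤ numSndContaining F e := by
  constructor
  · intro he
    refine Finset.card_le_card fun q hq => ?_
    rw [Finset.mem_filter] at hq ⊢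
    exact ⟨hq.1, hq.2.2 he⟩
  · intro hle
    by_contra he
    refine absurd (Finset.card_lt_card (Finset.ssubset_iff_subset_ne.2
      ⟨fun q hq => ?_, fun heq => ?_⟩)) (not_lt.2 hle)
    · rw [Finset.mem_filter] at hq ⊢
      rcases hF.2.1 p hp q hq.1 with hle | hle
      · exact absurd (hle.2 hq.2) he
      · exact ⟨hq.1, hle⟩
    · have : p ∈ F.filter fun q => e ∈ q.2 := by simp [heq, hp]
      exact he (Finset.mem_filter.1 this).2

theorem IsBiflag.eq_filter_rank (hF : IsBiflag F) (hp : p ∈ F) :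
    (Finset.univ.filter fun e => numFstMissing F e < bisubsetRank F p,
      Finset.univ.filter fun e => bisubsetRank F p ≤ numSndContaining F e) = p := by
  refine Prod.ext ?_ ?_ <;> ext e
  · simp [hF.mem_fst_iff hp]
  · simp [hF.mem_snd_iff hp]

theorem IsBiflag.image_bisubsetRank (hF : IsBiflag F) :
    F.image (bisubsetRank F) = Finset.Ioo 0 (F.card + 1) := by
  refine Finset.eq_of_subset_of_card_le ?_ ?_
  · intro m hm
    obtain ⟨p, hp, rfl⟩ := Finset.mem_image.1 hm
    rw [Finset.mem_Ioo]
    exact ⟨Finset.card_pos.2 ⟨p, by simp [hp]⟩, Nat.lt_succ_of_le (Finset.card_filter_le _ _)⟩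
  · have hinj : Set.InjOn (bisubsetRank F) F := fun p hp q hq h => by
      rw [← hF.eq_filter_rank hp, h, hF.eq_filter_rank hq]
    rw [Finset.card_image_of_injOn hinj]
    simp

theorem IsBiflag.numFstMissing_le_numSndContaining (hF : IsBiflag F) (e : α) :
    numFstMissing F e ≤ numSndContaining F e := by
  refine Finset.card_le_card fun p hp => ?_
  rw [Finset.mem_filter] at hp ⊢
  have he : e ∈ p.1 ∪ p.2 := (hF.1 p hp.1).2.2.1 ▸ Finset.mem_univ e
  exact ⟨hp.1, (Finset.mem_union.1 he).resolve_left hp.2⟩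

theorem IsBiflag.exists_numFstMissing_eq_numSndContaining (hF : IsBiflag F) :
    ∃ e, numFstMissing F e = numSndContaining F e := by
  obtain ⟨e, he⟩ : ∃ e, e ∉ F.biUnion fun p => p.1 ∩ p.2 := by
    by_contra! h
    exact hF.2.2 (Finset.eq_univ_iff_forall.2 h)
  refine ⟨e, (hF.numFstMissing_le_numSndContaining e).antisymm
    (Finset.card_le_card fun p hp => ?_)⟩
  rw [Finset.mem_filter] at hp ⊢
  exact ⟨hp.1, fun h1 => he (Finset.mem_biUnion.2 ⟨p, hp.1, Finset.mem_inter.2 ⟨h1, hp.2⟩⟩)⟩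

theorem IsBiflag.exists_numFstMissing_or_numSndContaining_eq (hF : IsBiflag F) {i : ℕ}
    (hi : i ≤ F.card) : ∃ e, numFstMissing F e = i ∨ numSndContaining F e = i := by
  have hrank : ∀ m, 0 < m → m ≤ F.card → ∃ p ∈ F, bisubsetRank F p = m := fun m h0 hm =>
    Finset.mem_image.1 (hF.image_bisubsetRank ▸ Finset.mem_Ioo.2 ⟨h0, Nat.lt_succ_of_le hm⟩)
  have hle : ∀ e, numFstMissing F e ≤ numSndContaining F e ∧ numSndContaining F e ≤ F.card :=
    fun e => ⟨hF.numFstMissing_le_numSndContaining e, Finset.card_filter_le _ _⟩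
  rcases hi.eq_or_lt with rfl | hlt
  · rcases Nat.eq_zero_or_pos F.card with h0 | h0
    · obtain ⟨e, -⟩ := hF.exists_numFstMissing_eq_numSndContaining
      have := hle e
      exact ⟨e, by omega⟩
    · obtain ⟨p, hp, hr⟩ := hrank F.card h0 le_rfl
      obtain ⟨e, he⟩ := (hF.1 p hp).2.1
      have := (hF.mem_snd_iff hp).1 he
      have := hle e
      exact ⟨e, by omega⟩
  · obtain ⟨q, hq, hrq⟩ := hrank (i + 1) (by omega) hlt
    rcases Nat.eq_zero_or_pos i with rfl | h0
    · obtain ⟨e, he⟩ := (hF.1 q hq).1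
      have := (hF.mem_fst_iff hq).1 he
      exact ⟨e, by omega⟩
    · obtain ⟨p, hp, hrp⟩ := hrank i h0 hi
      by_contra! hne
      have hpq : p = q := by
        refine Prod.ext ?_ ?_ <;> ext e <;> have := hne e
        · rw [hF.mem_fst_iff hp, hF.mem_fst_iff hq]
          omega
        · rw [hF.mem_snd_iff hp, hF.mem_snd_iff hq]
          omega
      subst hpq
      omega

theorem IsBiflag.exists_bisequence (hF : IsBiflag F) :
    ∃ L, IsBisequenceList L ∧ flagOfBisequence L = F := by
  have hle : ∀ e, numFstMissing F e ≤ numSndContaining F e ∧ numSndContaining F e ≤ F.card :=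
    fun e => ⟨hF.numFstMissing_le_numSndContaining e, Finset.card_filter_le _ _⟩
  refine ⟨partsOf F.card (numFstMissing F) (numSndContaining F),
    (isBisequenceList_partsOf_iff hle).2
      ⟨fun i hi => hF.exists_numFstMissing_or_numSndContaining_eq hi,
        hF.exists_numFstMissing_eq_numSndContaining⟩, ?_⟩
  rw [flagOfBisequence_partsOf hle, ← hF.image_bisubsetRank, Finset.image_image]
  conv_rhs => rw [← Finset.image_id (s := F)]
  exact Finset.image_congr fun p hp => hF.eq_filter_rank hp

end Biflag

/-- **Bisequences correspond to biflags.** Let `|E| = n + 1` with `n ≥ 1`. The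
assignment sending a bisequence `ℬ = (B_0, …, B_k)` to the collection of pairs
`S_i|T_i` (`1 ≤ i ≤ k`), with `S_i = B_0 ∪ ⋯ ∪ B_{i-1}` and `T_i = B_i ∪ ⋯ ∪ B_k`,
sends bisequences to flags of bisubsets, and is a bijection from the set of bisequences
on `E` onto the set of flags of bisubsets in `E`. -/
theorem bisequence_biflag_bijection (n : ℕ) (hn : 1 ≤ n) (hcard : Fintype.card α = n + 1) :
    (∀ L : List (Finset α), IsBisequenceList L → IsBiflag (flagOfBisequence L)) ∧
    Set.BijOn flagOfBisequence {L : List (Finset α) | IsBisequenceList L}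
      {F : Finset (Finset α × Finset α) | IsBiflag F} := by
  have hmaps : ∀ L : List (Finset α), IsBisequenceList L → IsBiflag (flagOfBisequence L) := by
    intro L hL
    obtain ⟨k, a, b, h, rfl⟩ := hL.exists_eq_partsOf
    exact isBiflag_flagOfBisequence_partsOf h hL
  refine ⟨hmaps, hmaps, ?_, fun F hF => hF.exists_bisequence⟩
  intro L hL L' hL' heq
  obtain ⟨k, a, b, h, rfl⟩ := hL.exists_eq_partsOf
  obtain ⟨k', a', b', h', rfl⟩ := hL'.exists_eq_partsOf
  rw [← partsOf_flagOfBisequence_partsOf h hL, heq, partsOf_flagOfBisequence_partsOf h' hL']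
end

section
/- Let E be a finite set, let ∅ ⊊ S_1 ⊆ S_2 ⊆ … ⊆ S_k ⊆ E be an increasing sequence of k nonempty subsets of E, and let E ⊇ T_1 ⊇ T_2 ⊇ … ⊇ T_k ⊋ ∅ be a decreasing sequence of k nonempty subsets of E; set S_0 = ∅, T_0 = E, S_{k+1} = E, T_{k+1} = ∅. Then the set of pairs {S_j|T_j : 1 ≤ j ≤ k} is a flag of bisubsets of E if and only if S_j ∪ T_j = E for every 1 ≤ j ≤ k and S_j ∪ T_{j+1} ≠ E for some 0 ≤ j ≤ k. -/
variable {α : Type*} [Fintype α] [DecidableEq α]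

/-- A family of finsets that increases at each step up to `n` is monotone up to `n + 1`. -/
theorem subset_of_forall_subset_succ {β : Type*} {n : ℕ} {S : ℕ → Finset β}
    (h : ∀ j ≤ n, S j ⊆ S (j + 1)) {i j : ℕ} (hij : i ≤ j) (hj : j ≤ n + 1) : S i ⊆ S j := by
  induction j, hij using Nat.le_induction with
  | base => exact Finset.Subset.refl _
  | succ m _ ih => exact (ih (by omega)).trans (h m (by omega))

/-- A family of finsets that decreases at each step up to `n` is antitone up to `n + 1`. -/
theorem subset_of_forall_succ_subset {β : Type*} {n : ℕ} {T : ℕ → Finset β}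
    (h : ∀ j ≤ n, T (j + 1) ⊆ T j) {i j : ℕ} (hij : i ≤ j) (hj : j ≤ n + 1) : T j ⊆ T i := by
  induction j, hij using Nat.le_induction with
  | base => exact Finset.Subset.refl _
  | succ m _ ih => exact (h m (by omega)).trans (ih (by omega))

/-- **Characterization of flags of bisubsets.** Given an increasing sequence
`∅ ⊊ S_1 ⊆ ⋯ ⊆ S_k ⊆ E` and a decreasing sequence `E ⊇ T_1 ⊇ ⋯ ⊇ T_k ⊋ ∅` of nonempty
subsets of `E` (with `S_0 = ∅`, `T_0 = E`, `S_{k+1} = E`, `T_{k+1} = ∅`), the set of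
pairs `{S_j|T_j : 1 ≤ j ≤ k}` is a flag of bisubsets of `E` if and only if
`S_j ∪ T_j = E` for every `1 ≤ j ≤ k` and `S_j ∪ T_{j+1} ≠ E` for some `0 ≤ j ≤ k`. -/
theorem isBiflag_iff (k : ℕ) (S T : ℕ → Finset α)
    (hS0 : S 0 = ∅) (hT0 : T 0 = Finset.univ)
    (hStop : S (k + 1) = Finset.univ) (hTtop : T (k + 1) = ∅)
    (hSne : ∀ j, 1 ≤ j → j ≤ k → (S j).Nonempty)
    (hTne : ∀ j, 1 ≤ j → j ≤ k → (T j).Nonempty)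
    (hSmono : ∀ j ≤ k, S j ⊆ S (j + 1))
    (hTmono : ∀ j ≤ k, T (j + 1) ⊆ T j) :
    IsBiflag ((Finset.Icc 1 k).image fun j => (S j, T j)) ↔
      (∀ j, 1 ≤ j → j ≤ k → S j ∪ T j = Finset.univ) ∧
      (∃ j ≤ k, S j ∪ T (j + 1) ≠ Finset.univ) := by
  have hS {i j : ℕ} (hij : i ≤ j) (hj : j ≤ k + 1) : S i ⊆ S j :=
    subset_of_forall_subset_succ hSmono hij hj
  have hT {i j : ℕ} (hij : i ≤ j) (hj : j ≤ k + 1) : T j ⊆ T i :=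
    subset_of_forall_succ_subset hTmono hij hj
  constructor
  · rintro ⟨hbi, -, hne⟩
    refine ⟨fun j h1 hk => (hbi (S j, T j) (Finset.mem_image.2
      ⟨j, Finset.mem_Icc.2 ⟨h1, hk⟩, rfl⟩)).2.2.1, ?_⟩
    obtain ⟨x, hx⟩ : ∃ x, ∀ i, 1 ≤ i → i ≤ k → x ∈ S i → x ∉ T i := by
      simpa [Finset.eq_univ_iff_forall] using hne
    classical
    have hex : ∃ i, x ∈ S i := ⟨k + 1, by simp [hStop]⟩
    obtain ⟨j, hj⟩ : ∃ j, Nat.find hex = j + 1 := by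
      refine Nat.exists_eq_succ_of_ne_zero fun h0 => ?_
      have := Nat.find_spec hex
      simp [h0, hS0] at this
    have hmem : x ∈ S (j + 1) := hj ▸ Nat.find_spec hex
    have hnot : x ∉ S j := Nat.find_min hex (by omega)
    have hjk : j ≤ k := by
      have : Nat.find hex ≤ k + 1 := Nat.find_min' hex (by simp [hStop])
      omega
    have hxT : x ∉ T (j + 1) := by
      rcases hjk.eq_or_lt with rfl | hlt
      · simp [hTtop]
      · exact hx (j + 1) (by omega) hlt hmem
    refine ⟨j, hjk, fun h => ?_⟩
    have : x ∈ S j ∪ T (j + 1) := h ▸ Finset.mem_univ x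
    simp [hnot, hxT] at this
  · rintro ⟨hun, j, hjk, hj⟩
    obtain ⟨x, hx⟩ : ∃ x, x ∉ S j ∪ T (j + 1) := by
      simpa [Finset.eq_univ_iff_forall] using hj
    rw [Finset.mem_union, not_or] at hx
    have hxi {i : ℕ} (hi : i ≤ k) : x ∉ S i ∩ T i := by
      rw [Finset.mem_inter]
      rintro ⟨hxS, hxT⟩
      rcases le_or_gt i j with hij | hij
      · exact hx.1 (hS hij (by omega) hxS)
      · exact hx.2 (hT hij (by omega) hxT)
    refine ⟨?_, ?_, fun h => ?_⟩
    · simp only [Finset.forall_mem_image, Finset.mem_Icc]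
      rintro i ⟨h1, hk⟩
      refine ⟨hSne i h1 hk, hTne i h1 hk, hun i h1 hk, fun h => hxi hk ?_⟩
      rw [Prod.mk.injEq] at h
      simp [h.1, h.2]
    · simp only [Finset.forall_mem_image, Finset.mem_Icc]
      rintro a ⟨-, ha⟩ b ⟨-, hb⟩
      rcases le_total a b with hab | hab
      · exact Or.inl ⟨hS hab (by omega), hT hab (by omega)⟩
      · exact Or.inr ⟨hS hab (by omega), hT hab (by omega)⟩
    · have hmem := h ▸ Finset.mem_univ x
      simp only [Finset.mem_biUnion, Finset.exists_mem_image, Finset.mem_Icc] at hmem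
      obtain ⟨i, ⟨-, hi⟩, hi'⟩ := hmem
      exact hxi hi hi'
end

section
/- Let E be a finite set with n+1 elements, n ≥ 1. For any two functions z, w : E → ℝ, there exist a flag of bisubsets {S_1|T_1, …, S_k|T_k} in E, nonnegative real numbers c_1, …, c_k, and real numbers λ, μ such that for every i ∈ E: z_i = λ + Σ_{j : i ∈ S_j} c_j and w_i = μ + Σ_{j : i ∈ T_j} c_j. (Equivalently, the cones spanned by the vectors e_S + f_T over the bisubsets S|T in a biflag, together with the lineality ℝ·e_E ⊕ ℝ·e_E, cover all of ℝ^E ⊕ ℝ^E.) -/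
variable {α : Type*} [Fintype α] [DecidableEq α]

open MeasureTheory in
/-- Summing the lengths of the fibers over the values satisfying a predicate gives the length
of the set of points whose value satisfies it. -/
theorem sum_volume_fibers {β : Type*} (f : ℝ → β)
    (hf : ∀ b, MeasurableSet (f ⁻¹' {b})) {I : Set ℝ} (hI : MeasurableSet I)
    (hfin : volume I ≠ ⊤) (F : Finset β) (hF : ∀ t ∈ I, f t ∈ F) (P : β → Prop)
    [DecidablePred P] :
    ∑ b ∈ F.filter P, volume.real (I ∩ f ⁻¹' {b}) = volume.real {t ∈ I | P (f t)} := by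
  rw [← measureReal_biUnion_finset]
  · congr 1
    ext t
    simp only [Finset.mem_filter, Set.mem_iUnion, Set.mem_inter_iff, Set.mem_preimage,
      Set.mem_singleton_iff, Set.mem_ofPred_eq, exists_prop]
    exact ⟨fun ⟨b, ⟨_, hP⟩, ht, hb⟩ => ⟨ht, hb ▸ hP⟩,
      fun ⟨ht, hP⟩ => ⟨f t, ⟨hF t ht, hP⟩, ht, rfl⟩⟩
  · intro b _ b' _ hne
    refine Set.disjoint_left.2 fun t ht ht' => hne ?_
    exact ht.2.symm.trans ht'.2
  · exact fun b _ => hI.inter (hf b)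

/-- For a family of intervals `[v i, u i]`, the pair formed by the intervals that have started
by the time `t` and those that have not yet ended. -/
noncomputable def startedAlive {ι : Type*} [Fintype ι] (v u : ι → ℝ) (t : ℝ) :
    Finset ι × Finset ι :=
  (Finset.univ.filter fun i => v i ≤ t, Finset.univ.filter fun i => t < u i)

theorem measurableSet_startedAlive_fiber {ι : Type*} [Fintype ι] (v u : ι → ℝ)
    (p : Finset ι × Finset ι) :
    MeasurableSet (startedAlive v u ⁻¹' {p}) := by
  have h : startedAlive v u ⁻¹' {p} =
      ⋂ i : ι, {t | v i ≤ t ↔ i ∈ p.1} ∩ {t | t < u i ↔ i ∈ p.2} := by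
    ext t
    simp [startedAlive, Prod.ext_iff, Finset.ext_iff, forall_and]
  rw [h]
  refine MeasurableSet.iInter fun i => MeasurableSet.inter ?_ ?_
  · exact measurableSet_Ici.iff (MeasurableSet.const _)
  · exact measurableSet_Iio.iff (MeasurableSet.const _)

theorem startedAlive_comparable_of_le {ι : Type*} [Fintype ι] (v u : ι → ℝ) {s t : ℝ}
    (h : s ≤ t) :
    (startedAlive v u s).1 ⊆ (startedAlive v u t).1 ∧
      (startedAlive v u t).2 ⊆ (startedAlive v u s).2 := by
  constructor <;> intro i hi <;> simp only [startedAlive, Finset.mem_filter] at hi ⊢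
  · exact ⟨hi.1, hi.2.trans h⟩
  · exact ⟨hi.1, h.trans_lt hi.2⟩

open MeasureTheory in
/-- **The cones of the biflags cover `ℝ^E ⊕ ℝ^E`.** Let `|E| = n + 1` with `n ≥ 1`. For
any `z, w : E → ℝ` there are a flag of bisubsets `{S_1|T_1, …, S_k|T_k}` in `E`,
nonnegative reals `c_1, …, c_k`, and reals `λ, μ` with
`z_i = λ + Σ_{j : i ∈ S_j} c_j` and `w_i = μ + Σ_{j : i ∈ T_j} c_j` for every `i ∈ E`. -/
theorem biflag_cones_cover (n : ℕ) (hn : 1 ≤ n) (hcard : Fintype.card α = n + 1)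
    (z w : α → ℝ) :
    ∃ (F : Finset (Finset α × Finset α)) (c : Finset α × Finset α → ℝ) (lam mu : ℝ),
      IsBiflag F ∧ (∀ p ∈ F, 0 ≤ c p) ∧
      (∀ i : α, z i = lam + ∑ p ∈ F.filter (fun p => i ∈ p.1), c p) ∧
      (∀ i : α, w i = mu + ∑ p ∈ F.filter (fun p => i ∈ p.2), c p) := by
  classical
  have : Nonempty α := Fintype.card_pos_iff.1 (by omega)
  obtain ⟨k, hk⟩ := Finite.exists_min fun i => z i + w i
  let v : α → ℝ := fun i => -z i
  let u : α → ℝ := fun i => w i - (z k + w k)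
  have hvu : ∀ i, v i ≤ u i := fun i => by dsimp only [v, u]; linarith [hk i]
  have hvuk : u k = v k := by dsimp only [v, u]; ring
  obtain ⟨a, ha⟩ := Finite.exists_min v
  obtain ⟨b, hb⟩ := Finite.exists_max u
  let f := startedAlive v u
  let I := Set.Ico (v a) (u b)
  have hk_notMem : ∀ t, k ∉ (f t).1 ∩ (f t).2 := fun t => by
    simp [f, startedAlive, hvuk]
  let F : Finset (Finset α × Finset α) := Finset.univ.filter fun p => ∃ t ∈ I, f t = p
  have hF : ∀ t ∈ I, f t ∈ F := fun t ht => Finset.mem_filter.2 ⟨Finset.mem_univ _, t, ht, rfl⟩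
  have hsum : ∀ (P : Finset α × Finset α → Prop) [DecidablePred P],
      ∑ p ∈ F.filter P, volume.real (I ∩ f ⁻¹' {p}) = volume.real {t ∈ I | P (f t)} :=
    fun P _ => sum_volume_fibers f (measurableSet_startedAlive_fiber v u) measurableSet_Ico
      (by simp) F hF P
  refine ⟨F, fun p => volume.real (I ∩ f ⁻¹' {p}), -u b, v a + (z k + w k),
    ⟨?_, ?_, ?_⟩, fun _ _ => measureReal_nonneg, fun i => ?_, fun i => ?_⟩
  · intro p hp
    obtain ⟨t, ht, rfl⟩ := (Finset.mem_filter.1 hp).2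
    refine ⟨⟨a, by simpa [f, startedAlive] using ht.1⟩,
      ⟨b, by simpa [f, startedAlive] using ht.2⟩, ?_, fun h => ?_⟩
    · ext i
      have := hvu i
      simp only [f, startedAlive, Finset.mem_union, Finset.mem_filter, Finset.mem_univ, true_and,
        iff_true]
      exact (le_or_gt (v i) t).imp_right fun h => h.trans_le this
    · exact hk_notMem t (by simp [h])
  · intro p hp q hq
    obtain ⟨s, -, rfl⟩ := (Finset.mem_filter.1 hp).2
    obtain ⟨t, -, rfl⟩ := (Finset.mem_filter.1 hq).2
    exact (le_total s t).imp (startedAlive_comparable_of_le v u)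
      (startedAlive_comparable_of_le v u)
  · intro h
    obtain ⟨p, hp, hkp⟩ := Finset.mem_biUnion.1 (h ▸ Finset.mem_univ k)
    obtain ⟨t, -, rfl⟩ := (Finset.mem_filter.1 hp).2
    exact hk_notMem t hkp
  · have hset : {t ∈ I | i ∈ (f t).1} = Set.Ico (v i) (u b) := by
      ext t
      have := ha i
      simp only [I, f, startedAlive, Set.mem_ofPred_eq, Set.mem_Ico, Finset.mem_filter,
        Finset.mem_univ, true_and]
      grind
    rw [hsum, hset, Real.volume_real_Ico_of_le ((hvu i).trans (hb i))]
    simp only [v]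
    ring
  · have hset : {t ∈ I | i ∈ (f t).2} = Set.Ico (v a) (u i) := by
      ext t
      have := hb i
      simp only [I, f, startedAlive, Set.mem_ofPred_eq, Set.mem_Ico, Finset.mem_filter,
        Finset.mem_univ, true_and]
      grind
    rw [hsum, hset, Real.volume_real_Ico_of_le ((ha i).trans (hvu i))]
    simp only [u]
    ring
end

section
/- Let M be a matroid on a nonempty finite ground set E, and let M✶ denote its dual matroid. Suppose z, w : E → ℝ satisfy: for every circuit C of M, there exist distinct elements i, j ∈ C with z_i = z_j = min_{c ∈ C} z_c; and for every circuit C' of M✶, there exist distinct elements i, j ∈ C' with w_i = w_j = min_{c ∈ C'} w_c. Then there exist distinct elements i, j ∈ E with z_i + w_i = z_j + w_j = min_{c ∈ E} (z_c + w_c). (In other words, trop(M) × trop(M✶) is contained in the tropical hypersurface trop(δ).) -/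
/-- A circuit of a matroid `M`: a minimal dependent set, i.e. a dependent set all of
whose proper subsets are independent. -/
def IsCircuit {α : Type*} (M : Matroid α) (C : Set α) : Prop :=
  M.Dep C ∧ ∀ D : Set α, D ⊂ C → M.Indep D

theorem isCircuit_of_matroid_isCircuit {α : Type*} {M : Matroid α} {C : Set α}
    (hC : M.IsCircuit C) : IsCircuit M C :=
  ⟨hC.dep, fun _ hD => hC.ssubset_indep hD⟩

/-- A ground element outside the closure of `X` lies in a cocircuit disjoint from `X`. -/
theorem Matroid.exists_isCocircuit_of_notMem_closure {α : Type*} {M : Matroid α} {X : Set α}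
    {e : α} (hX : X ⊆ M.E) (heE : e ∈ M.E) (he : e ∉ M.closure X) :
    ∃ K, M.IsCocircuit K ∧ e ∈ K ∧ Disjoint K X := by
  obtain ⟨I, hI⟩ := M.exists_isBasis X hX
  have heI : e ∉ M.closure I := by rwa [hI.closure_eq_closure]
  have hins : M.Indep (insert e I) := by
    rw [hI.indep.insert_indep_iff]
    exact Or.inl ⟨heE, heI⟩
  obtain ⟨B, hB, hIB⟩ := hins.exists_isBase_superset
  have heB : e ∈ B := hIB (Set.mem_insert e I)
  have hIBe : I ⊆ B \ {e} := fun x hx =>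
    ⟨hIB (Set.mem_insert_of_mem e hx), fun hxe =>
      heI (M.mem_closure_of_mem (hxe ▸ hx) hI.indep.subset_ground)⟩
  refine ⟨M.E \ M.closure (B \ {e}), hB.compl_closure_sdiff_singleton_isCocircuit heB,
    ⟨heE, hB.indep.notMem_closure_sdiff_of_mem heB⟩, ?_⟩
  exact Set.disjoint_sdiff_left.mono_right
    (hI.subset_closure.trans (M.closure_subset_closure hIBe))

/-- If the minimum of `f` over `C` is attained twice, no element of `C` is its unique minimizer. -/
theorem exists_ne_le_of_min_attained_twice {α : Type*} {f : α → ℝ} {C : Set α} {e : α}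
    (he : e ∈ C) (h : ∃ i ∈ C, ∃ j ∈ C, i ≠ j ∧ f i = f j ∧ ∀ c ∈ C, f i ≤ f c) :
    ∃ c ∈ C, c ≠ e ∧ f c ≤ f e := by
  obtain ⟨i, hi, j, hj, hij, hf, hmin⟩ := h
  by_cases hie : i = e
  · exact ⟨j, hj, fun hje => hij (hie.trans hje.symm), hf ▸ hmin e he⟩
  · exact ⟨i, hi, hie, hmin e he⟩

/-- **`trop(M) × trop(M✶)` is contained in the tropical hypersurface `trop(δ)`.**
Let `M` be a matroid on a nonempty finite ground set `E`, with dual matroid `M✶`.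
If `z` attains its minimum over every circuit of `M` at least twice, and `w` attains its
minimum over every circuit of `M✶` at least twice, then `z + w` attains its minimum over
`E` at least twice. -/
theorem tropM_times_tropMdual_subset_tropDelta {α : Type*} [Fintype α] [Nonempty α]
    (M : Matroid α) (hE : M.E = Set.univ) (z w : α → ℝ)
    (hz : ∀ C : Set α, IsCircuit M C →
      ∃ i ∈ C, ∃ j ∈ C, i ≠ j ∧ z i = z j ∧ ∀ c ∈ C, z i ≤ z c)
    (hw : ∀ C : Set α, IsCircuit M✶ C →
      ∃ i ∈ C, ∃ j ∈ C, i ≠ j ∧ w i = w j ∧ ∀ c ∈ C, w i ≤ w c) :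
    ∃ i j : α, i ≠ j ∧ z i + w i = z j + w j ∧ ∀ c : α, z i + w i ≤ z c + w c := by
  obtain ⟨e, hmin⟩ := Finite.exists_min (fun c => z c + w c)
  by_contra! hcon
  have hlt : ∀ c, c ≠ e → z e + w e < z c + w c := fun c hc =>
    (hmin c).lt_of_ne fun heq => by
      obtain ⟨d, hd⟩ := hcon e c hc.symm heq
      exact (hmin d).not_gt hd
  by_cases he : e ∈ M.closure {c | z e < z c}
  · obtain ⟨C, hCs, hC, heC⟩ := M.exists_isCircuit_of_mem_closure he (by simp)
    obtain ⟨c, hcC, hce, hc⟩ := exists_ne_le_of_min_attained_twice heC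
      (hz C (isCircuit_of_matroid_isCircuit hC))
    exact ((hCs hcC).resolve_left hce).not_ge hc
  · obtain ⟨K, hK, heK, hdisj⟩ := M.exists_isCocircuit_of_notMem_closure
      (hE ▸ Set.subset_univ _) (hE ▸ Set.mem_univ e) he
    obtain ⟨c, hcK, hce, hc⟩ := exists_ne_le_of_min_attained_twice heK
      (hw K (isCircuit_of_matroid_isCircuit hK.isCircuit))
    have hzc : z c ≤ z e := not_lt.mp fun h => Set.disjoint_left.mp hdisj hcK h
    linarith [hlt c hce]
end

section
/- Let M be a matroid on a finite ground set E, let F be a flat of M, and let G be a flat of the dual matroid M✶. If F ∪ G ≠ E, then the complement E − (F ∪ G) has at least two elements. In particular, the union of a flat of M and a flat of M✶ cannot have exactly |E| − 1 elements. -/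
/-- An element outside `D` is spanned by `D` in the dual matroid exactly when it is not spanned in
the matroid by the other elements outside `D`. -/
lemma Matroid.mem_dual_closure_iff_notMem_closure {α : Type*} {M : Matroid α} {D : Set α} {e : α}
    (he : e ∈ M.E) (heD : e ∉ D) :
    e ∈ M✶.closure D ↔ e ∉ M.closure ((M.E \ D) \ {e}) := by
  have hloop : (M✶.contract D).IsLoop e ↔ (M.delete D).IsColoop e := by
    rw [← M.dual_delete, dual_isLoop_iff_isColoop]
  simpa [contract_isLoop_iff_mem_closure, delete_isColoop_iff, he, heD] using hloop

/-- The complement of the union of a flat and a coflat is not a singleton. -/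
lemma Matroid.ground_sdiff_flat_union_coflat_ne_singleton {α : Type*} {M : Matroid α}
    {F G : Set α} (hF : M.IsFlat F) (hG : M✶.IsFlat G) (e : α) : M.E \ (F ∪ G) ≠ {e} := by
  intro h
  obtain ⟨heE, heFG⟩ : e ∈ M.E \ (F ∪ G) := h ▸ Set.mem_singleton e
  rw [Set.mem_union, not_or] at heFG
  have hcl : e ∈ M.closure ((M.E \ G) \ {e}) := by
    by_contra hcon
    exact heFG.2 (hG.closure ▸ (mem_dual_closure_iff_notMem_closure heE heFG.2).2 hcon)
  have hsub : (M.E \ G) \ {e} ⊆ F := by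
    rintro x ⟨⟨hxE, hxG⟩, hxe⟩
    by_contra hxF
    exact hxe (h ▸ ⟨hxE, by simp [hxF, hxG]⟩)
  exact heFG.1 (hF.closure ▸ M.closure_subset_closure hsub hcl)


/-- **The union of a flat and a coflat misses at least two elements when proper.**
Let `M` be a matroid on a finite ground set `E`, let `F` be a flat of `M` (a set closed
under the closure operator of `M`) and let `G` be a flat of the dual matroid `M✶`.
If `F ∪ G ≠ E`, then `E − (F ∪ G)` has at least two elements; in particular `F ∪ G`
cannot have exactly `|E| − 1` elements. -/
theorem flat_union_coflat {α : Type*} [Fintype α] (M : Matroid α) (hE : M.E = Set.univ)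
    (F G : Set α) (hF : M.closure F = F) (hG : M✶.closure G = G) :
    (F ∪ G ≠ Set.univ → 2 ≤ (Set.univ \ (F ∪ G)).ncard) ∧
    ((F ∪ G).ncard : ℤ) ≠ (Fintype.card α : ℤ) - 1 := by
  have hne : (Set.univ \ (F ∪ G)).ncard ≠ 1 := fun h ↦ by
    obtain ⟨e, he⟩ := Set.ncard_eq_one.1 h
    exact Matroid.ground_sdiff_flat_union_coflat_ne_singleton
      (Matroid.isFlat_iff_closure_eq.2 hF) (Matroid.isFlat_iff_closure_eq.2 hG) e (hE ▸ he)
  constructor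
  · intro hU
    have hpos : (Set.univ \ (F ∪ G)).ncard ≠ 0 := fun h ↦ by
      rw [Set.ncard_eq_zero, Set.sdiff_eq_empty] at h
      exact hU (Set.univ_subset_iff.1 h)
    omega
  · have hcard := Set.ncard_sdiff_add_ncard_of_subset (Set.subset_univ (F ∪ G))
    rw [Set.ncard_univ, Nat.card_eq_fintype_card] at hcard
    omega
end
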